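/- arXiv:1405.1313 — 2 statements merged into one kernel-verified Lean document; each statement's English description precedes it below -/
import Mathlib

section
/- Every signed-graphic matroid is representable over GF(3). More precisely, if A is the incidence matrix over GF(3) of an oriented signed graph Ω, then the column matroid M[A] equals the frame matroid of Ω. -/
open Set

/-- A signed graph: each edge has an unordered pair of endpoints, and `neg` is
the set of negative edges. -/
structure SGraph (V E : Type*) where
  ends : E → Sym2 V
  neg : Set E

namespace SGraph

variable {V E : Type*}

/-- A cycle in a signed graph: `n ≥ 1` distinct vertices and `n` distinct edges
arranged cyclically. -/
structure Cyc (G : SGraph V E) where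
  n : ℕ
  hn : 0 < n
  vtx : ZMod n → V
  edge : ZMod n → E
  vtx_inj : Function.Injective vtx
  edge_inj : Function.Injective edge
  incid : ∀ i, G.ends (edge i) = s(vtx i, vtx (i + 1))

def Cyc.edges {G : SGraph V E} (C : Cyc G) : Set E := Set.range C.edge

def Cyc.vertices {G : SGraph V E} (C : Cyc G) : Set V := Set.range C.vtx

/-- A cycle is positive with respect to a set `N` of negative edges if it
contains an even number of edges from `N`. -/
def Cyc.PositiveIn {G : SGraph V E} (C : Cyc G) (N : Set E) : Prop :=
  Even (C.edges ∩ N).ncard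

def Cyc.Positive {G : SGraph V E} (C : Cyc G) : Prop := C.PositiveIn G.neg

def Cyc.Negative {G : SGraph V E} (C : Cyc G) : Prop := ¬ C.Positive

/-- A path joining the vertex set `S` to the vertex set `T`, internally
disjoint from `S ∪ T`. -/
structure ConnPath (G : SGraph V E) (S T : Set V) where
  n : ℕ
  vtx : Fin (n + 1) → V
  edge : Fin n → E
  vtx_inj : Function.Injective vtx
  edge_inj : Function.Injective edge
  incid : ∀ i : Fin n, G.ends (edge i) = s(vtx i.castSucc, vtx i.succ)
  first_mem : vtx 0 ∈ S
  last_mem : vtx (Fin.last n) ∈ T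
  internal : ∀ i : Fin (n + 1), i ≠ 0 → i ≠ Fin.last n → vtx i ∉ S ∪ T

def ConnPath.edges {G : SGraph V E} {S T : Set V} (P : ConnPath G S T) : Set E :=
  Set.range P.edge

/-- The circuits of the frame matroid of a signed graph: positive cycles, pairs
of negative cycles meeting in exactly one vertex, and pairs of vertex-disjoint
negative cycles together with a minimal connecting path. -/
inductive FrameCircuit (G : SGraph V E) : Set E → Prop
  | pos (C : Cyc G) (h : C.Positive) : FrameCircuit G C.edges
  | tight (C₁ C₂ : Cyc G) (h₁ : C₁.Negative) (h₂ : C₂.Negative)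
      (hne : C₁.edges ≠ C₂.edges) (v : V)
      (hmeet : C₁.vertices ∩ C₂.vertices = {v}) :
      FrameCircuit G (C₁.edges ∪ C₂.edges)
  | loose (C₁ C₂ : Cyc G) (h₁ : C₁.Negative) (h₂ : C₂.Negative)
      (hV : Disjoint C₁.vertices C₂.vertices)
      (P : ConnPath G C₁.vertices C₂.vertices) :
      FrameCircuit G (C₁.edges ∪ C₂.edges ∪ P.edges)

end SGraph

/-- `C` is a circuit of the matroid `M`: a minimal dependent set. -/
def Matroid.IsCircuit' {E : Type*} (M : Matroid E) (C : Set E) : Prop :=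
  C ⊆ M.E ∧ ¬ M.Indep C ∧ ∀ D ⊂ C, M.Indep D

/-- `M` is the frame matroid of the signed graph `G`: its ground set is all
edges and its circuits are exactly the frame circuits of `G`. -/
def SGraph.IsFrameMatroid {V E : Type*} (G : SGraph V E) (M : Matroid E) : Prop :=
  M.E = Set.univ ∧ ∀ C : Set E, M.IsCircuit' C ↔ G.FrameCircuit C

/-- `A` is an incidence matrix of an orientation of the signed graph `G`:
a positive link contributes opposite-signed entries `±1` at its endpoints,
a negative link contributes equal-signed entries, a negative loop contributes a
single nonzero entry, a positive loop contributes a zero column, and all other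
entries vanish. -/
def SGraph.IsIncidence {V E : Type*} (G : SGraph V E) (A : Matrix V E (ZMod 3)) : Prop :=
  ∀ e : E,
    (∀ w : V, w ∉ G.ends e → A w e = 0) ∧
    (∀ u v : V, G.ends e = s(u, v) → u ≠ v →
      A u e ≠ 0 ∧ A v e ≠ 0 ∧
        ((e ∈ G.neg → A u e = A v e) ∧ (e ∉ G.neg → A u e = - A v e))) ∧
    (∀ v : V, G.ends e = s(v, v) →
      ((e ∈ G.neg → A v e ≠ 0) ∧ (e ∉ G.neg → A v e = 0)))

/-- `M` is the column matroid of the matrix `A`: the independent sets of `M`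
are exactly the linearly independent sets of columns of `A`. -/
def IsColMatroid {V E F : Type*} [Field F] (A : Matrix V E F) (M : Matroid E) : Prop :=
  M.E = Set.univ ∧
    ∀ X : Set E, M.Indep X ↔ LinearIndependent F (fun x : X => fun v => A v (x : E))

namespace SGraph

variable {V E : Type*}

open Classical in
/-- The sign of an edge in GF(3). -/
noncomputable def sg (G : SGraph V E) (e : E) : ZMod 3 := if e ∈ G.neg then -1 else 1

open Classical in
/-- Indicator vector of a vertex. -/
noncomputable def dl (u x : V) : ZMod 3 := if x = u then 1 else 0

lemma dl_self (u : V) : dl u u = 1 := by simp [dl]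

lemma dl_ne {u x : V} (h : x ≠ u) : dl u x = 0 := by simp [dl, h]

lemma sg_cases (G : SGraph V E) (e : E) : G.sg e = 1 ∨ G.sg e = -1 := by
  unfold sg; split_ifs <;> simp

lemma prod_sg_cases {ι : Type*} (G : SGraph V E) (e : ι → E) (s : Finset ι) :
    ∏ i ∈ s, G.sg (e i) = 1 ∨ ∏ i ∈ s, G.sg (e i) = -1 := by
  classical
  induction s using Finset.induction_on with
  | empty => simp
  | insert a s ha ih =>
    rw [Finset.prod_insert ha]
    rcases sg_cases G (e a) with h | h <;> rcases ih with h' | h' <;> simp [h, h']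

lemma col_form {G : SGraph V E} {A : Matrix V E (ZMod 3)} (hA : G.IsIncidence A)
    {e : E} {u w : V} (h : G.ends e = s(u, w)) :
    ∃ a : ZMod 3, a ≠ 0 ∧ ∀ x, A x e = a * (dl u x - G.sg e * dl w x) := by
  obtain ⟨h1, h2, h3⟩ := hA e
  have hz : ∀ x, x ≠ u → x ≠ w → A x e = 0 := by
    intro x hu hw
    apply h1
    rw [h]; simp [hu, hw]
  by_cases huw : u = w
  · subst huw
    obtain ⟨h4, h5⟩ := h3 u h
    by_cases hn : e ∈ G.neg
    · refine ⟨- A u e, by simpa using h4 hn, fun x => ?_⟩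
      by_cases hx : x = u
      · subst hx
        rw [dl_self, sg, if_pos hn]
        generalize A x e = a
        revert a; decide
      · rw [hz x hx hx, dl_ne hx]; simp
    · refine ⟨1, by decide, fun x => ?_⟩
      by_cases hx : x = u
      · subst hx
        rw [dl_self, sg, if_neg hn, h5 hn]; simp
      · rw [hz x hx hx, dl_ne hx]; simp
  · obtain ⟨h4, h5, h6, h7⟩ := h2 u w h huw
    refine ⟨A u e, h4, fun x => ?_⟩
    by_cases hx : x = u
    · subst hx
      rw [dl_self, dl_ne huw]; simp
    · by_cases hx' : x = w
      · subst hx'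
        rw [dl_self, dl_ne hx, sg]
        split_ifs with hn
        · rw [h6 hn]; simp
        · rw [h7 hn]; simp
      · rw [hz x hx hx', dl_ne hx, dl_ne hx']; simp

lemma seg_tele (n : ℕ) (v : ℕ → V) (g s : ℕ → ZMod 3)
    (hg : ∀ i < n, g i = (∏ j ∈ Finset.range i, s j) * g 0) (x : V) :
    ∑ i ∈ Finset.range n, g i * (dl (v i) x - s i * dl (v (i + 1)) x) =
      g 0 * (dl (v 0) x - (∏ j ∈ Finset.range n, s j) * dl (v n) x) := by
  induction n with
  | zero => simp
  | succ n ih =>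
    rw [Finset.sum_range_succ, ih (fun i hi => hg i (by omega)), hg n (by omega),
      Finset.prod_range_succ]
    ring

lemma seg_prop (n : ℕ) (v : ℕ → V) (g s : ℕ → ZMod 3)
    (hv : ∀ i j, 0 < i → i < n → j ≤ n → v i = v j → i = j)
    (hF : ∀ j, 0 < j → j < n →
      ∑ i ∈ Finset.range n, g i * (dl (v i) (v j) - s i * dl (v (i + 1)) (v j)) = 0) :
    ∀ i < n, g i = (∏ j ∈ Finset.range i, s j) * g 0 := by
  intro i
  induction i with
  | zero => simp
  | succ i ih =>
    intro hi
    have h := hF (i + 1) (by omega) hi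
    have key : ∀ t ∈ Finset.range n,
        g t * (dl (v t) (v (i + 1)) - s t * dl (v (t + 1)) (v (i + 1))) =
        (if t = i + 1 then g t else 0) - (if t = i then g t * s t else 0) := by
      intro t ht
      rw [Finset.mem_range] at ht
      by_cases h1 : t = i + 1
      · subst h1
        rw [dl_self, dl_ne]
        · simp
        · intro h2
          have := hv _ _ (by omega) hi (by omega) h2
          omega
      · have e1 : dl (v t) (v (i + 1)) = 0 := by
          apply dl_ne
          intro h2
          exact h1 (hv _ _ (by omega) hi (by omega) h2).symm
        by_cases h3 : t = i
        · subst h3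
          rw [dl_self, e1]; simp
        · have e2 : dl (v (t + 1)) (v (i + 1)) = 0 := by
            apply dl_ne
            intro h2
            have := hv _ _ (by omega) hi (by omega) h2
            omega
          simp [e1, e2, h1, h3]
    rw [Finset.sum_congr rfl key, Finset.sum_sub_distrib, Finset.sum_ite_eq',
      Finset.sum_ite_eq', if_pos (by simpa using hi), if_pos (by simp; omega),
      sub_eq_zero] at h
    rw [h, ih (by omega), Finset.prod_range_succ]
    ring

/-- A walk of length `n` indexed by natural numbers. -/
def IsSeg (G : SGraph V E) (n : ℕ) (v : ℕ → V) (e : ℕ → E) : Prop :=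
  ∀ i < n, G.ends (e i) = s(v i, v (i + 1))

/-- The linear combination of columns given by `f`. -/
noncomputable def lc (A : Matrix V E (ZMod 3)) (f : E →₀ ZMod 3) (x : V) : ZMod 3 :=
  f.sum fun e c => c * A x e

lemma lc_add (A : Matrix V E (ZMod 3)) (f g : E →₀ ZMod 3) (x : V) :
    lc A (f + g) x = lc A f x + lc A g x := by
  classical
  unfold lc
  apply Finsupp.sum_add_index' <;> intros <;> ring

lemma lc_single (A : Matrix V E (ZMod 3)) (e : E) (c : ZMod 3) (x : V) :
    lc A (Finsupp.single e c) x = c * A x e := by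
  unfold lc
  simp

lemma seg_exists {G : SGraph V E} {A : Matrix V E (ZMod 3)} (hA : G.IsIncidence A)
    {n : ℕ} {v : ℕ → V} {e : ℕ → E} (hs : G.IsSeg n v e)
    (he : ∀ i j, i < n → j < n → e i = e j → i = j) (c : ZMod 3) :
    ∃ f : E →₀ ZMod 3, (∀ x, lc A f x =
        c * (dl (v 0) x - (∏ j ∈ Finset.range n, G.sg (e j)) * dl (v n) x)) ∧
      (∀ y, f y ≠ 0 → ∃ i < n, y = e i) ∧ (0 < n → c ≠ 0 → f (e 0) ≠ 0) := by
  induction n with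
  | zero => exact ⟨0, by simp [lc], by simp, by simp⟩
  | succ n ih =>
    obtain ⟨f, h1, h2, h3⟩ := ih (fun i hi => hs i (by omega))
      (fun i j hi hj => he i j (by omega) (by omega))
    obtain ⟨a, ha, hcol⟩ := col_form hA (hs n (by omega))
    refine ⟨f + Finsupp.single (e n) (a⁻¹ * c * ∏ j ∈ Finset.range n, G.sg (e j)), ?_, ?_, ?_⟩
    · intro x
      rw [lc_add, h1, lc_single, hcol, Finset.prod_range_succ]
      field_simp
      ring
    · intro y hy
      by_cases hyn : y = e n
      · exact ⟨n, by omega, hyn⟩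
      · rw [Finsupp.add_apply, Finsupp.single_eq_of_ne hyn, add_zero] at hy
        obtain ⟨i, hi, rfl⟩ := h2 y hy
        exact ⟨i, by omega, rfl⟩
    · intro _ hc
      by_cases hn : n = 0
      · subst hn
        have : f (e 0) = 0 := by
          by_contra hne
          obtain ⟨i, hi, _⟩ := h2 _ hne
          omega
        simp [this, ha, hc]
      · have : e 0 ≠ e n := by
          intro h
          exact hn (he 0 n (by omega) (by omega) h).symm
        rw [Finsupp.add_apply, Finsupp.single_eq_of_ne this, add_zero]
        exact h3 (by omega) hc

lemma seg_unique {G : SGraph V E} {A : Matrix V E (ZMod 3)} (hA : G.IsIncidence A)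
    {n : ℕ} {v : ℕ → V} {e : ℕ → E} (hs : G.IsSeg n v e)
    (hv : ∀ i j, 0 < i → i < n → j ≤ n → v i = v j → i = j)
    (f : E → ZMod 3)
    (hF : ∀ j, 0 < j → j < n → ∑ i ∈ Finset.range n, f (e i) * A (v j) (e i) = 0) :
    ∃ c : ZMod 3, (∀ i < n, (f (e i) = 0 ↔ c = 0)) ∧
      ∀ x, ∑ i ∈ Finset.range n, f (e i) * A x (e i) =
        c * (dl (v 0) x - (∏ j ∈ Finset.range n, G.sg (e j)) * dl (v n) x) := by
  have hex : ∀ i, ∃ a : ZMod 3, a ≠ 0 ∧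
      (i < n → ∀ x, A x (e i) = a * (dl (v i) x - G.sg (e i) * dl (v (i + 1)) x)) := by
    intro i
    by_cases hi : i < n
    · obtain ⟨a, ha, h⟩ := col_form hA (hs i hi)
      exact ⟨a, ha, fun _ => h⟩
    · exact ⟨1, by decide, fun h => absurd h hi⟩
  choose a ha hcol using hex
  have hsum : ∀ x, ∑ i ∈ Finset.range n, f (e i) * A x (e i) =
      ∑ i ∈ Finset.range n, (f (e i) * a i) *
        (dl (v i) x - G.sg (e i) * dl (v (i + 1)) x) := by
    intro x
    apply Finset.sum_congr rfl
    intro i hi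
    rw [hcol i (by simpa using hi)]
    ring
  have hg := seg_prop n v (fun i => f (e i) * a i) (fun i => G.sg (e i)) hv
    (fun j h1 h2 => by rw [← hsum]; exact hF j h1 h2)
  refine ⟨f (e 0) * a 0, ?_, ?_⟩
  · intro i hi
    have h := hg i hi
    constructor
    · intro h0
      rw [h0] at h
      rcases prod_sg_cases G e (Finset.range i) with h' | h' <;> rw [h'] at h <;>
        simpa using h.symm
    · intro h0
      rw [h0] at h
      simpa [ha i] using h
  · intro x
    rw [hsum, seg_tele n v _ _ hg]

lemma A_zero {G : SGraph V E} {A : Matrix V E (ZMod 3)} (hA : G.IsIncidence A)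
    {e : E} {u w x : V} (h : G.ends e = s(u, w)) (hu : x ≠ u) (hw : x ≠ w) : A x e = 0 := by
  apply (hA e).1
  rw [h]; simp [hu, hw]

/-- A nat-indexed cycle. -/
structure NCyc (G : SGraph V E) (n : ℕ) (v : ℕ → V) (e : ℕ → E) : Prop where
  pos : 0 < n
  seg : G.IsSeg n v e
  wrap : v n = v 0
  vinj : ∀ i j, i < n → j < n → v i = v j → i = j
  einj : ∀ i j, i < n → j < n → e i = e j → i = j

lemma NCyc.vint {G : SGraph V E} {n : ℕ} {v : ℕ → V} {e : ℕ → E} (h : G.NCyc n v e) :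
    ∀ i j, 0 < i → i < n → j ≤ n → v i = v j → i = j := by
  intro i j h0 hi hj hij
  rcases Nat.lt_or_eq_of_le hj with hj | rfl
  · exact h.vinj i j hi hj hij
  · rw [h.wrap] at hij
    have := h.vinj i 0 hi h.pos hij
    omega

/-- Product of signs. -/
noncomputable def sgn (G : SGraph V E) (n : ℕ) (e : ℕ → E) : ZMod 3 :=
  ∏ j ∈ Finset.range n, G.sg (e j)

/-- Minimal dependence, phrased with kernel vectors. -/
def KCirc (A : Matrix V E (ZMod 3)) (C : Set E) : Prop :=
  (∃ f : E →₀ ZMod 3, f ≠ 0 ∧ (∀ y, f y ≠ 0 → y ∈ C) ∧ ∀ x, lc A f x = 0) ∧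
  ∀ f : E →₀ ZMod 3, (∀ y, f y ≠ 0 → y ∈ C) → (∀ x, lc A f x = 0) →
    ∀ y ∈ C, f y = 0 → f = 0

lemma lc_eq_sum (A : Matrix V E (ZMod 3)) (f : E →₀ ZMod 3) (s : Finset E)
    (h : ∀ y, f y ≠ 0 → y ∈ s) (x : V) : lc A f x = ∑ y ∈ s, f y * A x y := by
  unfold lc
  apply Finsupp.sum_of_support_subset
  · intro y hy
    exact h y (by simpa using hy)
  · simp

lemma kcirc_pos {G : SGraph V E} {A : Matrix V E (ZMod 3)} (hA : G.IsIncidence A)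
    {n : ℕ} {v : ℕ → V} {e : ℕ → E} (h : G.NCyc n v e) (hs : G.sgn n e = 1) :
    KCirc A {y | ∃ i < n, y = e i} := by
  classical
  constructor
  · obtain ⟨f, h1, h2, h3⟩ := seg_exists hA h.seg h.einj 1
    refine ⟨f, ?_, h2, ?_⟩
    · rintro rfl
      exact h3 h.pos (by decide) rfl
    · intro x
      rw [h1, h.wrap]
      unfold sgn at hs
      rw [hs]; simp
  · intro f hf hk y hy hfy
    have hsum : ∀ x, lc A f x = ∑ i ∈ Finset.range n, f (e i) * A x (e i) := by
      intro x
      rw [lc_eq_sum A f ((Finset.range n).image e), Finset.sum_image]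
      · intro i hi j hj hij
        exact h.einj i j (by simpa using hi) (by simpa using hj) hij
      · intro y hy
        obtain ⟨i, hi, rfl⟩ := hf y hy
        exact Finset.mem_image_of_mem _ (by simpa using hi)
    obtain ⟨c, hc, -⟩ := seg_unique hA h.seg h.vint f (fun j _ _ => by rw [← hsum]; exact hk _)
    obtain ⟨i, hi, rfl⟩ := hy
    have hc0 := (hc i hi).1 hfy
    ext y
    by_contra hne
    obtain ⟨i, hi, rfl⟩ := hf y hne
    exact hne ((hc i hi).2 hc0)

lemma neg_indep {G : SGraph V E} {A : Matrix V E (ZMod 3)} (hA : G.IsIncidence A)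
    {n : ℕ} {v : ℕ → V} {e : ℕ → E} (h : G.NCyc n v e) (hs : G.sgn n e = -1)
    (f : E → ZMod 3) (hf : ∀ x, ∑ i ∈ Finset.range n, f (e i) * A x (e i) = 0) :
    ∀ i < n, f (e i) = 0 := by
  obtain ⟨c, hc, hx⟩ := seg_unique hA h.seg h.vint f (fun j _ _ => hf _)
  have := hx (v 0)
  unfold sgn at hs
  rw [hf, hs, h.wrap, dl_self] at this
  intro i hi
  rw [hc i hi]
  revert this
  generalize c = c
  revert c; decide

lemma kcirc_cuff {G : SGraph V E} {A : Matrix V E (ZMod 3)} (hA : G.IsIncidence A)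
    {n₁ n₂ m : ℕ} {v₁ v₂ p : ℕ → V} {e₁ e₂ q : ℕ → E}
    (h₁ : G.NCyc n₁ v₁ e₁) (hs₁ : G.sgn n₁ e₁ = -1)
    (h₂ : G.NCyc n₂ v₂ e₂) (hs₂ : G.sgn n₂ e₂ = -1)
    (hp : G.IsSeg m p q) (hpinj : ∀ i j, i ≤ m → j ≤ m → p i = p j → i = j)
    (hp₁ : p 0 = v₁ 0) (hp₂ : p m = v₂ 0)
    (hd₁ : ∀ i j, 0 < i → i < n₁ → j ≤ n₂ → v₁ i ≠ v₂ j)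
    (hd₂ : ∀ i j, 0 < i → i < n₂ → j ≤ n₁ → v₂ i ≠ v₁ j)
    (hq₁ : ∀ i j, 0 < i → i < n₁ → j ≤ m → v₁ i ≠ p j)
    (hq₂ : ∀ i j, 0 < i → i < n₂ → j ≤ m → v₂ i ≠ p j)
    (he₁₂ : ∀ i j, i < n₁ → j < n₂ → e₁ i ≠ e₂ j) :
    KCirc A ({y | ∃ i < n₁, y = e₁ i} ∪ {y | ∃ i < n₂, y = e₂ i} ∪ {y | ∃ i < m, y = q i}) := by
  classical
  have hqinj : ∀ i j, i < m → j < m → q i = q j → i = j := by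
    intro i j hi hj hij
    have h := hp i hi
    rw [hij, hp j hj, Sym2.eq_iff] at h
    rcases h with ⟨h, _⟩ | ⟨h, h'⟩
    · exact (hpinj _ _ (by omega) (by omega) h).symm
    · have := hpinj _ _ (by omega) (by omega) h
      have := hpinj _ _ (by omega) (by omega) h'
      omega
  have aux : ∀ (n : ℕ) (v : ℕ → V) (e : ℕ → E), G.NCyc n v e →
      (∀ i j, 0 < i → i < n → j ≤ m → v i ≠ p j) → ∀ i j, i < n → j < m → e i ≠ q j := by
    intro n v e h hq i j hi hj hij
    have h' := h.seg i hi
    rw [hij, hp j hj] at h'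
    have a1 : i = 0 := by
      by_contra hne
      rw [Sym2.eq_iff] at h'
      rcases h' with ⟨h', _⟩ | ⟨_, h'⟩
      · exact hq i _ (by omega) hi (by omega) h'.symm
      · exact hq i _ (by omega) hi (by omega) h'.symm
    have a2 : i + 1 = n := by
      by_contra hne
      rw [Sym2.eq_iff] at h'
      rcases h' with ⟨_, h'⟩ | ⟨h', _⟩
      · exact hq (i+1) _ (by omega) (by omega) (by omega) h'.symm
      · exact hq (i+1) _ (by omega) (by omega) (by omega) h'.symm
    rw [a2, h.wrap, a1, Sym2.eq_iff] at h'
    have : p j = p (j + 1) := by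
      rcases h' with ⟨h', h''⟩ | ⟨h', h''⟩ <;> rw [h', h'']
    have := hpinj _ _ (by omega) (by omega) this
    omega
  have he₁q := aux n₁ v₁ e₁ h₁ hq₁
  have he₂q := aux n₂ v₂ e₂ h₂ hq₂
  have hm : m = 0 ∨ v₁ 0 ≠ v₂ 0 := by
    by_contra! h
    have := hpinj 0 m (by omega) (by omega) (by rw [hp₁, hp₂, h.2])
    omega
  unfold sgn at hs₁ hs₂
  constructor
  · obtain ⟨f, f1, f2, f3⟩ := seg_exists hA h₁.seg h₁.einj 1
    obtain ⟨g, g1, g2, -⟩ := seg_exists hA hp hqinj 1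
    obtain ⟨k, k1, k2, -⟩ := seg_exists hA h₂.seg h₂.einj
      (2 * ∏ j ∈ Finset.range m, G.sg (q j))
    refine ⟨f + k + g, ?_, ?_, ?_⟩
    · intro h0
      apply f3 h₁.pos (by decide)
      have : (f + k + g) (e₁ 0) = 0 := by rw [h0]; rfl
      have hk0 : k (e₁ 0) = 0 := by
        by_contra hne
        obtain ⟨i, hi, h⟩ := k2 _ hne
        exact he₁₂ _ _ h₁.pos hi h
      have hg0 : g (e₁ 0) = 0 := by
        by_contra hne
        obtain ⟨i, hi, h⟩ := g2 _ hne
        exact he₁q _ _ h₁.pos hi h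
      simpa [hk0, hg0] using this
    · intro y hy
      by_contra hc
      simp only [Set.mem_union, Set.mem_ofPred_eq, not_or] at hc
      apply hy
      have a1 : f y = 0 := by
        by_contra h; exact hc.1.1 (f2 y h)
      have a2 : k y = 0 := by
        by_contra h; exact hc.1.2 (k2 y h)
      have a3 : g y = 0 := by
        by_contra h; exact hc.2 (g2 y h)
      simp [a1, a2, a3]
    · intro x
      rw [lc_add, lc_add, f1, g1, k1, hs₁, hs₂, h₁.wrap, h₂.wrap, hp₁, hp₂]
      generalize dl (v₁ 0) x = a
      generalize dl (v₂ 0) x = b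
      generalize ∏ j ∈ Finset.range m, G.sg (q j) = c
      revert a b c
      decide
  · intro f hf hk y hy hfy
    have hsum : ∀ x, lc A f x = ∑ i ∈ Finset.range n₁, f (e₁ i) * A x (e₁ i) +
        ∑ i ∈ Finset.range n₂, f (e₂ i) * A x (e₂ i) +
        ∑ i ∈ Finset.range m, f (q i) * A x (q i) := by
      intro x
      rw [lc_eq_sum A f ((Finset.range n₁).image e₁ ∪ (Finset.range n₂).image e₂ ∪
        (Finset.range m).image q), Finset.sum_union, Finset.sum_union,
        Finset.sum_image, Finset.sum_image, Finset.sum_image]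
      · intro i hi j hj hij
        exact hqinj i j (by simpa using hi) (by simpa using hj) hij
      · intro i hi j hj hij
        exact h₂.einj i j (by simpa using hi) (by simpa using hj) hij
      · intro i hi j hj hij
        exact h₁.einj i j (by simpa using hi) (by simpa using hj) hij
      · rw [Finset.disjoint_left]
        intro y hy hy'
        simp only [Finset.mem_image, Finset.mem_range] at hy hy'
        obtain ⟨i, hi, rfl⟩ := hy
        obtain ⟨j, hj, h⟩ := hy'
        exact he₁₂ i j hi hj h.symm
      · rw [Finset.disjoint_left]
        intro y hy hy'
        simp only [Finset.mem_image, Finset.mem_range, Finset.mem_union] at hy hy'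
        obtain ⟨j, hj, h⟩ := hy'
        rcases hy with ⟨i, hi, rfl⟩ | ⟨i, hi, rfl⟩
        · exact he₁q i j hi hj h.symm
        · exact he₂q i j hi hj h.symm
      · intro y hy
        simp only [Finset.mem_image, Finset.mem_range, Finset.mem_union]
        rcases hf y hy with (⟨i, hi, rfl⟩ | ⟨i, hi, rfl⟩) | ⟨i, hi, rfl⟩
        · exact Or.inl (Or.inl ⟨i, hi, rfl⟩)
        · exact Or.inl (Or.inr ⟨i, hi, rfl⟩)
        · exact Or.inr ⟨i, hi, rfl⟩
    have hz : ∀ (n : ℕ) (v : ℕ → V) (e : ℕ → E) (x : V), G.IsSeg n v e →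
        (∀ j ≤ n, x ≠ v j) → ∑ i ∈ Finset.range n, f (e i) * A x (e i) = 0 := by
      intro n v e x hs hx
      apply Finset.sum_eq_zero
      intro i hi
      rw [Finset.mem_range] at hi
      rw [A_zero hA (hs i hi) (hx _ (by omega)) (hx _ (by omega)), mul_zero]
    obtain ⟨c, hc, hcx⟩ := seg_unique hA h₁.seg h₁.vint f (fun j hj hj' => by
      have := hsum (v₁ j)
      rw [hk, hz n₂ v₂ e₂ _ h₂.seg (fun t ht => hd₁ _ _ hj hj' ht),
        hz m p q _ hp (fun t ht => hq₁ _ _ hj hj' ht)] at this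
      simpa using this.symm)
    obtain ⟨d, hd, hdx⟩ := seg_unique hA h₂.seg h₂.vint f (fun j hj hj' => by
      have := hsum (v₂ j)
      rw [hk, hz n₁ v₁ e₁ _ h₁.seg (fun t ht => hd₂ _ _ hj hj' ht),
        hz m p q _ hp (fun t ht => hq₂ _ _ hj hj' ht)] at this
      simpa using this.symm)
    obtain ⟨b, hb, hbx⟩ := seg_unique hA hp
      (fun i j _ hi hj h => hpinj i j (by omega) hj h) f (fun j hj hj' => by
      have := hsum (p j)
      rw [hk, hcx, hdx, h₁.wrap, h₂.wrap, ← hp₁, ← hp₂, dl_ne, dl_ne] at this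
      · simpa using this.symm
      · intro h
        have := hpinj _ _ (by omega) (by omega) h
        omega
      · intro h
        have := hpinj _ _ (by omega) (by omega) h
        omega)
    have htot : ∀ x, c * (dl (v₁ 0) x - (-1) * dl (v₁ 0) x) +
        d * (dl (v₂ 0) x - (-1) * dl (v₂ 0) x) +
        b * (dl (v₁ 0) x - (∏ j ∈ Finset.range m, G.sg (q j)) * dl (v₂ 0) x) = 0 := by
      intro x
      rw [← hk x, hsum, hcx, hdx, hbx, hs₁, hs₂, h₁.wrap, h₂.wrap, hp₁, hp₂]
    have hall : c = 0 ∧ d = 0 ∧ (0 < m → b = 0) := by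
      have hor : c = 0 ∨ d = 0 ∨ (0 < m ∧ b = 0) := by
        rcases hy with (⟨i, hi, rfl⟩ | ⟨i, hi, rfl⟩) | ⟨i, hi, rfl⟩
        · exact Or.inl ((hc i hi).1 hfy)
        · exact Or.inr (Or.inl ((hd i hi).1 hfy))
        · exact Or.inr (Or.inr ⟨by omega, (hb i hi).1 hfy⟩)
      rcases hm with hm | hm
      · subst hm
        have h := htot (v₁ 0)
        have h12 : v₁ 0 = v₂ 0 := by rw [← hp₁, ← hp₂]
        rw [← h12, dl_self, Finset.range_zero, Finset.prod_empty] at h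
        simp only [lt_irrefl, false_and, or_false, IsEmpty.forall_iff, and_true] at hor ⊢
        clear hc hd hb hcx hdx hbx htot
        revert c d b
        decide
      · have h := htot (v₁ 0)
        have h' := htot (v₂ 0)
        rw [dl_self, dl_ne hm] at h
        rw [dl_self, dl_ne hm.symm] at h'
        have hor' : c = 0 ∨ d = 0 ∨ b = 0 := by tauto
        have : c = 0 ∧ d = 0 ∧ b = 0 := by
          clear hc hd hb hcx hdx hbx htot hor
          rcases prod_sg_cases G q (Finset.range m) with h3 | h3 <;> rw [h3] at h h' <;>
          · clear h3
            revert c d b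
            decide
        exact ⟨this.1, this.2.1, fun _ => this.2.2⟩
    ext y
    by_contra hne
    rcases hf y hne with (⟨i, hi, rfl⟩ | ⟨i, hi, rfl⟩) | ⟨i, hi, rfl⟩
    · exact hne ((hc i hi).2 hall.1)
    · exact hne ((hd i hi).2 hall.2.1)
    · exact hne ((hb i hi).2 (hall.2.2 (by omega)))

lemma cyc_sign {G : SGraph V E} (n : ℕ) (e : ℕ → E)
    (he : ∀ i j, i < n → j < n → e i = e j → i = j) :
    Even ({y | ∃ i < n, y = e i} ∩ G.neg).ncard ↔ G.sgn n e = 1 := by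
  classical
  have h1 : ({y | ∃ i < n, y = e i} ∩ G.neg) =
      (((Finset.range n).filter (fun i => e i ∈ G.neg)).image e : Finset E) := by
    ext y
    simp only [Set.mem_inter_iff, Set.mem_ofPred_eq, Finset.coe_image, Set.mem_image,
      Finset.mem_coe, Finset.mem_filter, Finset.mem_range]
    constructor
    · rintro ⟨⟨i, hi, rfl⟩, hy⟩
      exact ⟨i, ⟨hi, hy⟩, rfl⟩
    · rintro ⟨i, ⟨hi, hy⟩, rfl⟩
      exact ⟨⟨i, hi, rfl⟩, hy⟩
  rw [h1, Set.ncard_coe_finset, Finset.card_image_of_injOn]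
  · unfold sgn sg
    rw [Finset.prod_ite, Finset.prod_const, Finset.prod_const_one, mul_one]
    generalize (Finset.filter (fun i => e i ∈ G.neg) (Finset.range n)).card = k
    rcases Nat.even_or_odd k with h | h
    · simp [h]
    · have : ¬ Even k := by simpa using h
      simp only [this, h.neg_one_pow, false_iff]
      decide
  · intro i hi j hj hij
    simp only [Finset.coe_filter, Finset.mem_range, Set.mem_ofPred_eq] at hi hj
    exact he i j hi.1 hj.1 hij

lemma sgn_cases (G : SGraph V E) (n : ℕ) (e : ℕ → E) : G.sgn n e = 1 ∨ G.sgn n e = -1 :=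
  prod_sg_cases G e _

lemma natCast_inj_zmod {n i j : ℕ} (a : ZMod n) (hi : i < n) (hj : j < n)
    (h : a + (i : ZMod n) = a + (j : ZMod n)) : i = j := by
  have h := add_left_cancel h
  rw [ZMod.natCast_eq_natCast_iff'] at h
  rwa [Nat.mod_eq_of_lt hi, Nat.mod_eq_of_lt hj] at h

/-- Unrolling of a cycle starting at a prescribed vertex. -/
lemma Cyc.unroll {G : SGraph V E} (C : Cyc G) (a : ZMod C.n) :
    ∃ v : ℕ → V, ∃ e : ℕ → E, G.NCyc C.n v e ∧ v 0 = C.vtx a ∧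
      C.edges = {y | ∃ i < C.n, y = e i} ∧ C.vertices = {y | ∃ i < C.n, y = v i} ∧
      (C.Positive ↔ G.sgn C.n e = 1) ∧ (∀ i, v i ∈ C.vertices) := by
  have hn := C.hn
  have : NeZero C.n := ⟨hn.ne'⟩
  have hE : C.edges = {y | ∃ i < C.n, y = C.edge (a + (i : ℕ))} := by
    ext y
    simp only [Cyc.edges, Set.mem_range, Set.mem_ofPred_eq]
    constructor
    · rintro ⟨x, rfl⟩
      exact ⟨(x - a).val, ZMod.val_lt _, by simp⟩
    · rintro ⟨i, _, rfl⟩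
      exact ⟨_, rfl⟩
  have hinj : ∀ i j, i < C.n → j < C.n →
      C.edge (a + (i : ℕ)) = C.edge (a + (j : ℕ)) → i = j := fun i j hi hj h =>
    natCast_inj_zmod a hi hj (C.edge_inj h)
  refine ⟨fun i => C.vtx (a + (i : ℕ)), fun i => C.edge (a + (i : ℕ)), ⟨hn, ?_, ?_, ?_, hinj⟩,
    by simp, hE, ?_, ?_, ?_⟩
  · intro i _
    rw [C.incid]
    push_cast
    rw [add_assoc]
  · simp
  · intro i j hi hj h
    exact natCast_inj_zmod a hi hj (C.vtx_inj h)
  · ext y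
    simp only [Cyc.vertices, Set.mem_range, Set.mem_ofPred_eq]
    constructor
    · rintro ⟨x, rfl⟩
      exact ⟨(x - a).val, ZMod.val_lt _, by simp⟩
    · rintro ⟨i, _, rfl⟩
      exact ⟨_, rfl⟩
  · rw [← cyc_sign _ _ hinj, ← hE]
    rfl
  · intro i
    exact ⟨_, rfl⟩

lemma NCyc.toCyc {G : SGraph V E} {n : ℕ} {v : ℕ → V} {e : ℕ → E} (h : G.NCyc n v e) :
    ∃ C : Cyc G, C.edges = {y | ∃ i < n, y = e i} ∧ C.vertices = {y | ∃ i < n, y = v i} ∧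
      (C.Positive ↔ G.sgn n e = 1) := by
  have : NeZero n := ⟨h.pos.ne'⟩
  let C : Cyc G :=
    { n := n
      hn := h.pos
      vtx := fun x => v x.val
      edge := fun x => e x.val
      vtx_inj := fun x y hxy => ZMod.val_injective n
        (h.vinj _ _ (ZMod.val_lt _) (ZMod.val_lt _) hxy)
      edge_inj := fun x y hxy => ZMod.val_injective n
        (h.einj _ _ (ZMod.val_lt _) (ZMod.val_lt _) hxy)
      incid := by
        intro x
        have hx := ZMod.val_lt x
        rw [h.seg _ hx]
        suffices hv : v (x.val + 1) = v (x + 1).val by rw [hv]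
        have : (x + 1).val = (x.val + 1) % n := by
          rw [ZMod.val_add, ZMod.val_one_eq_one_mod, Nat.add_mod_mod]
        rw [this]
        by_cases hlt : x.val + 1 < n
        · rw [Nat.mod_eq_of_lt hlt]
        · have : x.val + 1 = n := by omega
          rw [this, Nat.mod_self, h.wrap] }
  have hE : C.edges = {y | ∃ i < n, y = e i} := by
    ext y
    simp only [Cyc.edges, Set.mem_range, Set.mem_ofPred_eq, C]
    constructor
    · rintro ⟨x, rfl⟩
      exact ⟨x.val, ZMod.val_lt _, rfl⟩
    · rintro ⟨i, hi, rfl⟩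
      exact ⟨(i : ZMod n), by rw [ZMod.val_natCast_of_lt hi]⟩
  refine ⟨C, hE, ?_, ?_⟩
  · ext y
    simp only [Cyc.vertices, Set.mem_range, Set.mem_ofPred_eq, C]
    constructor
    · rintro ⟨x, rfl⟩
      exact ⟨x.val, ZMod.val_lt _, rfl⟩
    · rintro ⟨i, hi, rfl⟩
      exact ⟨(i : ZMod n), by rw [ZMod.val_natCast_of_lt hi]⟩
  · rw [← cyc_sign _ _ h.einj, ← hE]
    rfl

lemma neg_of {G : SGraph V E} {C : Cyc G} {n : ℕ} {e : ℕ → E} (h : C.Negative)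
    (hs : C.Positive ↔ G.sgn n e = 1) : G.sgn n e = -1 := by
  rcases sgn_cases G n e with h1 | h1
  · exact absurd (hs.2 h1) h
  · exact h1

lemma frameCircuit_kcirc {G : SGraph V E} {A : Matrix V E (ZMod 3)} (hA : G.IsIncidence A)
    {C : Set E} (hC : G.FrameCircuit C) : KCirc A C := by
  cases hC with
  | pos C h =>
    obtain ⟨v, e, hN, -, hE, -, hs, -⟩ := C.unroll 0
    rw [hE]
    exact kcirc_pos hA hN (hs.1 h)
  | tight C₁ C₂ h₁ h₂ hne w hmeet =>
    have hw : w ∈ C₁.vertices ∩ C₂.vertices := by rw [hmeet]; rfl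
    obtain ⟨⟨a₁, ha₁⟩, ⟨a₂, ha₂⟩⟩ := hw
    obtain ⟨v₁, e₁, hN₁, hz₁, hE₁, hV₁, hs₁, hm₁⟩ := C₁.unroll a₁
    obtain ⟨v₂, e₂, hN₂, hz₂, hE₂, hV₂, hs₂, hm₂⟩ := C₂.unroll a₂
    have hcom : ∀ i j, v₁ i = v₂ j → v₁ i = w := by
      intro i j hij
      have : v₁ i ∈ C₁.vertices ∩ C₂.vertices := ⟨hm₁ i, hij ▸ hm₂ j⟩
      rw [hmeet] at this
      exact this
    have hd₁ : ∀ i j, 0 < i → i < C₁.n → v₁ i ≠ v₂ j := by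
      intro i j hi hi' hij
      have := hcom i j hij
      rw [← ha₁, ← hz₁] at this
      have := hN₁.vinj _ _ hi' hN₁.pos this
      omega
    have hd₂ : ∀ i j, 0 < i → i < C₂.n → v₂ i ≠ v₁ j := by
      intro i j hi hi' hij
      have := hcom j i hij.symm
      rw [← hij, ← ha₂, ← hz₂] at this
      have := hN₂.vinj _ _ hi' hN₂.pos this
      omega
    have key := kcirc_cuff hA (m := 0) (p := fun _ => w) (q := e₁) hN₁ (neg_of h₁ hs₁)
      hN₂ (neg_of h₂ hs₂) (fun i hi => absurd hi (by omega)) (fun i j hi hj _ => by omega)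
      (by simp [hz₁, ha₁]) (by simp [hz₂, ha₂])
      (fun i j hi hi' _ => hd₁ i j hi hi') (fun i j hi hi' _ => hd₂ i j hi hi')
      (fun i j hi hi' _ h => by
        rw [← ha₂, ← hz₂] at h; exact hd₁ i 0 hi hi' h)
      (fun i j hi hi' _ h => by
        rw [← ha₁, ← hz₁] at h; exact hd₂ i 0 hi hi' h) ?_
    · rw [hE₁, hE₂]
      convert key using 1
      simp
    · intro i j hi hj hij
      apply hne
      have h := hN₁.seg i hi
      rw [hij, hN₂.seg j hj, Sym2.eq_iff] at h
      have b1 : i = 0 := by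
        by_contra hc
        rcases h with ⟨h, _⟩ | ⟨_, h⟩ <;> exact hd₁ i _ (by omega) hi h.symm
      have b2 : i + 1 = C₁.n := by
        by_contra hc
        rcases h with ⟨_, h⟩ | ⟨h, _⟩ <;> exact hd₁ (i + 1) _ (by omega) (by omega) h.symm
      have b3 : j = 0 := by
        by_contra hc
        rcases h with ⟨h, _⟩ | ⟨h, _⟩ <;> exact hd₂ j _ (by omega) hj h
      have b4 : j + 1 = C₂.n := by
        by_contra hc
        rcases h with ⟨_, h⟩ | ⟨_, h⟩ <;> exact hd₂ (j + 1) _ (by omega) (by omega) h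
      subst b1 b3
      rw [hE₁, hE₂, ← b2, ← b4]
      simp [hij]
  | loose C₁ C₂ h₁ h₂ hV P =>
    obtain ⟨a₁, ha₁⟩ := P.first_mem
    obtain ⟨a₂, ha₂⟩ := P.last_mem
    obtain ⟨v₁, e₁, hN₁, hz₁, hE₁, hV₁, hs₁, hm₁⟩ := C₁.unroll a₁
    obtain ⟨v₂, e₂, hN₂, hz₂, hE₂, hV₂, hs₂, hm₂⟩ := C₂.unroll a₂
    have hd : ∀ i j, v₁ i ≠ v₂ j := by
      intro i j hij
      exact Set.disjoint_left.1 hV (hm₁ i) (hij ▸ hm₂ j)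
    have hinner : ∀ j (hj : j ≤ P.n), 0 < j → j < P.n →
        P.vtx ⟨j, by omega⟩ ∉ C₁.vertices ∪ C₂.vertices := by
      intro j hj h0 h1
      apply P.internal
      · intro h
        rw [Fin.ext_iff] at h
        simp at h
        omega
      · intro h
        rw [Fin.ext_iff] at h
        simp at h
        omega
    have hn0 : P.n ≠ 0 := by
      intro h0
      have : (Fin.last P.n) = 0 := by
        rw [Fin.ext_iff]; simpa using h0
      have h1 := P.last_mem
      rw [this] at h1
      exact Set.disjoint_left.1 hV P.first_mem h1
    let p : ℕ → V := fun i => if h : i < P.n + 1 then P.vtx ⟨i, h⟩ else P.vtx 0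
    let q : ℕ → E := fun i => if h : i < P.n then P.edge ⟨i, h⟩ else e₁ 0
    have hpv : ∀ j (h : j < P.n + 1), p j = P.vtx ⟨j, h⟩ := fun j h => dif_pos h
    have hqv : ∀ j (h : j < P.n), q j = P.edge ⟨j, h⟩ := fun j h => dif_pos h
    have hp0 : p 0 = v₁ 0 := by
      rw [hpv 0 (by omega), hz₁, ha₁]; rfl
    have hpn : p P.n = v₂ 0 := by
      rw [hpv P.n (by omega), hz₂, ha₂]; rfl
    have key := kcirc_cuff hA (m := P.n) (p := p) (q := q) hN₁ (neg_of h₁ hs₁)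
      hN₂ (neg_of h₂ hs₂) (fun i hi => by
        rw [hqv i hi, P.incid, hpv i (by omega), hpv (i + 1) (by omega)]; rfl)
      (fun i j hi hj h => by
        rw [hpv i (by omega), hpv j (by omega)] at h
        simpa using P.vtx_inj h)
      hp0 hpn (fun i j _ _ _ => hd i j) (fun i j _ _ _ => (hd j i).symm) ?_ ?_ ?_
    · rw [hE₁, hE₂]
      convert key using 2
      ext y
      simp only [ConnPath.edges, Set.mem_range, Set.mem_ofPred_eq]
      constructor
      · rintro ⟨x, rfl⟩
        exact ⟨x.1, x.2, by rw [hqv _ x.2]⟩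
      · rintro ⟨i, hi, rfl⟩
        exact ⟨⟨i, hi⟩, by rw [hqv _ hi]⟩
    · intro i j hi hi' hj h
      rcases Nat.eq_zero_or_pos j with rfl | hj0
      · rw [hp0] at h
        have := hN₁.vinj _ _ hi' hN₁.pos h
        omega
      · rcases Nat.lt_or_eq_of_le hj with hj1 | rfl
        · rw [hpv j (by omega)] at h
          exact hinner j hj hj0 hj1 (Or.inl (h ▸ hm₁ i))
        · rw [hpn] at h
          exact hd _ _ h
    · intro i j hi hi' hj h
      rcases Nat.eq_zero_or_pos j with rfl | hj0
      · rw [hp0] at h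
        exact hd _ _ h.symm
      · rcases Nat.lt_or_eq_of_le hj with hj1 | rfl
        · rw [hpv j (by omega)] at h
          exact hinner j hj hj0 hj1 (Or.inr (h ▸ hm₂ i))
        · rw [hpn] at h
          have := hN₂.vinj _ _ hi' hN₂.pos h
          omega
    · intro i j hi hj hij
      have h := hN₁.seg i hi
      rw [hij, hN₂.seg j hj, Sym2.eq_iff] at h
      rcases h with ⟨h, _⟩ | ⟨h, _⟩ <;> exact hd _ _ h.symm

/-- A path of length `m` with vertices `v 0, ..., v m`. -/
structure NPath (G : SGraph V E) (m : ℕ) (v : ℕ → V) (e : ℕ → E) : Prop where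
  seg : G.IsSeg m v e
  vinj : ∀ i j, i ≤ m → j ≤ m → v i = v j → i = j

lemma NPath.einj {G : SGraph V E} {m : ℕ} {v : ℕ → V} {e : ℕ → E} (h : G.NPath m v e) :
    ∀ i j, i < m → j < m → e i = e j → i = j := by
  intro i j hi hj hij
  have h' := h.seg i hi
  rw [hij, h.seg j hj, Sym2.eq_iff] at h'
  rcases h' with ⟨h', _⟩ | ⟨h', h''⟩
  · exact (h.vinj _ _ (by omega) (by omega) h').symm
  · have := h.vinj _ _ (by omega) (by omega) h'
    have := h.vinj _ _ (by omega) (by omega) h''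
    omega

lemma NPath.close {G : SGraph V E} {m : ℕ} {v : ℕ → V} {e : ℕ → E} (hp : G.NPath m v e)
    {h : E} (hh : G.ends h = s(v m, v 0)) (hne : ∀ i < m, e i ≠ h) :
    ∃ C : Cyc G, C.n = m + 1 ∧ C.edges = {y | y = h ∨ ∃ t < m, y = e t} ∧
      C.vertices = {y | ∃ t ≤ m, y = v t} ∧ (C.Positive ↔ G.sgn m e * G.sg h = 1) := by
  have hN : G.NCyc (m + 1) (fun t => if t ≤ m then v t else v 0)
      (fun t => if t < m then e t else h) := by
    refine ⟨by omega, ?_, by simp, ?_, ?_⟩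
    · intro i hi
      by_cases him : i < m
      · have h1 : i ≤ m := by omega
        have h2 : i + 1 ≤ m := by omega
        simp only [him, h1, h2, if_true]
        exact hp.seg i him
      · have : i = m := by omega
        subst this
        simp [hh]
    · intro i j hi hj hij
      have h1 : i ≤ m := by omega
      have h2 : j ≤ m := by omega
      simp only [h1, h2, if_true] at hij
      exact hp.vinj _ _ h1 h2 hij
    · intro i j hi hj hij
      by_cases h1 : i < m <;> by_cases h2 : j < m <;> simp only [h1, h2, if_true, if_false] at hij
      · exact hp.einj _ _ h1 h2 hij
      · exact absurd hij (hne i h1)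
      · exact absurd hij.symm (hne j h2)
      · omega
  have hs : G.sgn (m + 1) (fun t => if t < m then e t else h) = G.sgn m e * G.sg h := by
    unfold sgn
    rw [Finset.prod_range_succ]
    simp only [lt_irrefl, if_false]
    congr 1
    apply Finset.prod_congr rfl
    intro i hi
    rw [if_pos (by simpa using hi)]
  obtain ⟨C, hE, hV, hP⟩ := hN.toCyc
  have hE' : C.edges = {y | y = h ∨ ∃ t < m, y = e t} := by
    rw [hE]
    ext y
    simp only [Set.mem_ofPred_eq]
    constructor
    · rintro ⟨i, hi, rfl⟩
      by_cases him : i < m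
      · right; exact ⟨i, him, by simp [him]⟩
      · left; simp [him]
    · rintro (rfl | ⟨i, hi, rfl⟩)
      · exact ⟨m, by omega, by simp⟩
      · exact ⟨i, by omega, by simp [hi]⟩
  have hn : C.n = m + 1 := by
    have hn := C.hn
    have : NeZero C.n := ⟨hn.ne'⟩
    have h1 : C.edges.ncard = C.n := by
      unfold Cyc.edges
      rw [← Set.image_univ, Set.ncard_image_of_injective _ C.edge_inj, Set.ncard_univ,
        Nat.card_zmod]
    have h2 : C.edges.ncard = m + 1 := by
      rw [hE]
      have : {y | ∃ i < m + 1, y = (fun t => if t < m then e t else h) i} =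
          (fun t => if t < m then e t else h) '' (Set.Iio (m + 1)) := by
        ext y
        simp only [Set.mem_ofPred_eq, Set.mem_image, Set.mem_Iio]
        constructor
        · rintro ⟨i, hi, rfl⟩; exact ⟨i, hi, rfl⟩
        · rintro ⟨i, hi, rfl⟩; exact ⟨i, hi, rfl⟩
      rw [this, Set.InjOn.ncard_image]
      · rw [← Finset.coe_Iio, Set.ncard_coe_finset]; simp
      · intro i hi j hj hij
        exact hN.einj i j hi hj hij
    omega
  refine ⟨C, hn, hE', ?_, by rw [hP, hs]⟩
  rw [hV]
  ext y
  simp only [Set.mem_ofPred_eq]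
  constructor
  · rintro ⟨i, hi, rfl⟩
    exact ⟨i, by omega, by rw [if_pos (by omega)]⟩
  · rintro ⟨i, hi, rfl⟩
    exact ⟨i, by omega, by rw [if_pos hi]⟩

lemma double_chord {G : SGraph V E} {k : ℕ} {v : ℕ → V} {e : ℕ → E} (hp : G.NPath k v e)
    {g h : E} {i j : ℕ} (hi : i ≤ k) (hj : j ≤ k) (hh : G.ends h = s(v 0, v i))
    (hg : G.ends g = s(v j, v k)) (hgh : g ≠ h) (hhe : ∀ t < k, e t ≠ h)
    (hge : ∀ t < k, e t ≠ g) {X : Set E} (hX : ∀ t < k, e t ∈ X) (hgX : g ∈ X) (hhX : h ∈ X) :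
    ∃ D ⊆ X, G.FrameCircuit D := by
  have p1 : G.NPath i v e := ⟨fun t ht => hp.seg t (by omega),
    fun a b ha hb => hp.vinj a b (by omega) (by omega)⟩
  obtain ⟨C₁, -, hE₁, hV₁, hP₁⟩ := p1.close (h := h) (by rw [hh, Sym2.eq_swap])
    (fun t ht => hhe t (by omega))
  have hC₁X : C₁.edges ⊆ X := by
    rw [hE₁]
    rintro y (rfl | ⟨t, ht, rfl⟩)
    · exact hhX
    · exact hX t (by omega)
  have p2 : G.NPath (k - j) (fun t => v (j + t)) (fun t => e (j + t)) :=
    ⟨fun t ht => hp.seg (j + t) (by omega),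
    fun a b ha hb hab => by have := hp.vinj _ _ (by omega) (by omega) hab; omega⟩
  obtain ⟨C₂, -, hE₂, hV₂, hP₂⟩ := p2.close (h := g)
    (by rw [hg, Sym2.eq_swap, Nat.add_sub_cancel' hj]; rfl)
    (fun t ht => hge _ (by omega))
  have hC₂X : C₂.edges ⊆ X := by
    rw [hE₂]
    rintro y (rfl | ⟨t, ht, rfl⟩)
    · exact hgX
    · exact hX _ (by omega)
  by_cases h₁ : C₁.Positive
  · exact ⟨_, hC₁X, .pos C₁ h₁⟩
  by_cases h₂ : C₂.Positive
  · exact ⟨_, hC₂X, .pos C₂ h₂⟩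
  rcases lt_trichotomy i j with hij | hij | hij
  · have hdis : Disjoint C₁.vertices C₂.vertices := by
      rw [Set.disjoint_left, hV₁, hV₂]
      rintro _ ⟨t, ht, rfl⟩ ⟨s, hs, hts⟩
      have := hp.vinj _ _ (by omega) (by omega) hts
      omega
    let P : ConnPath G C₁.vertices C₂.vertices :=
      { n := j - i
        vtx := fun x => v (i + x.val)
        edge := fun x => e (i + x.val)
        vtx_inj := fun x y hxy => by
          have h1 := x.2
          have h2 := y.2
          have := hp.vinj _ _ (by omega) (by omega) hxy
          exact Fin.ext (by omega)
        edge_inj := fun x y hxy => by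
          have h1 := x.2
          have h2 := y.2
          have := hp.einj _ _ (by omega) (by omega) hxy
          exact Fin.ext (by omega)
        incid := fun x => by
          have h1 := x.2
          exact hp.seg _ (by omega)
        first_mem := by
          rw [hV₁]
          exact ⟨i, le_rfl, by simp⟩
        last_mem := by
          rw [hV₂]
          exact ⟨0, by omega, by simp [Nat.add_sub_cancel' hij.le]⟩
        internal := fun x hx hx' => by
          have h1 := x.2
          have h2 : x.val ≠ 0 := fun hc => hx (Fin.ext (by simpa using hc))
          have h3 : x.val ≠ j - i := fun hc => hx' (Fin.ext (by simpa using hc))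
          rw [hV₁, hV₂]
          rintro (⟨t, ht, hts⟩ | ⟨t, ht, hts⟩)
          · have := hp.vinj _ _ (by omega) (by omega) hts
            omega
          · have := hp.vinj _ _ (by omega) (by omega) hts
            omega }
    refine ⟨_, ?_, .loose C₁ C₂ h₁ h₂ hdis P⟩
    apply Set.union_subset (Set.union_subset hC₁X hC₂X)
    rintro _ ⟨x, rfl⟩
    have h1 : x.val < j - i := x.2
    exact hX _ (by omega)
  · subst hij
    refine ⟨_, Set.union_subset hC₁X hC₂X, .tight C₁ C₂ h₁ h₂ ?_ (v i) ?_⟩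
    · intro hEE
      have : h ∈ C₂.edges := by
        rw [← hEE, hE₁]; exact Or.inl rfl
      rw [hE₂] at this
      rcases this with h' | ⟨t, ht, h'⟩
      · exact hgh h'.symm
      · exact hhe _ (by omega) h'.symm
    · ext y
      rw [hV₁, hV₂]
      simp only [Set.mem_inter_iff, Set.mem_ofPred_eq, Set.mem_singleton_iff]
      constructor
      · rintro ⟨⟨t, ht, rfl⟩, ⟨s, hs, hts⟩⟩
        have := hp.vinj _ _ (by omega) (by omega) hts
        have : t = i := by omega
        rw [this]
      · rintro rfl
        exact ⟨⟨i, le_rfl, rfl⟩, ⟨0, by omega, by simp⟩⟩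
  · have p3 : G.NPath (j + 1 + (k - i)) (fun t => if t ≤ j then v t else v (k - (t - j - 1)))
        (fun t => if t < j then e t else if t = j then g else e (k - 1 - (t - j - 1))) := by
      constructor
      · intro t ht
        rcases lt_trichotomy t j with h1 | h1 | h1
        · have a1 : t ≤ j := by omega
          have a2 : t + 1 ≤ j := by omega
          simp only [h1, a1, a2, if_true]
          exact hp.seg t (by omega)
        · subst h1
          simp [hg]
        · have a1 : ¬ t ≤ j := by omega
          have a2 : ¬ t + 1 ≤ j := by omega
          have a3 : ¬ t < j := by omega
          have a4 : ¬ t = j := by omega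
          simp only [a1, a2, a3, a4, if_false]
          have a5 : k - 1 - (t - j - 1) + 1 = k - (t - j - 1) := by omega
          have a6 : k - (t + 1 - j - 1) = k - 1 - (t - j - 1) := by omega
          rw [hp.seg _ (by omega), Sym2.eq_swap, a5, a6]
      · intro a b ha hb hab
        by_cases h1 : a ≤ j <;> by_cases h2 : b ≤ j <;>
          simp only [h1, h2, if_true, if_false] at hab <;>
          · have := hp.vinj _ _ (by omega) (by omega) hab
            omega
    obtain ⟨C₃, -, hE₃, -, hP₃⟩ := p3.close (h := h)
      (by
        have a1 : ¬ (j + 1 + (k - i) ≤ j) := by omega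
        have a2 : k - (j + 1 + (k - i) - j - 1) = i := by omega
        simp only [a1, a2, if_false, Nat.zero_le, if_true]
        rw [hh, Sym2.eq_swap])
      (fun t ht => by
        split_ifs
        · exact hhe _ (by omega)
        · exact hgh
        · exact hhe _ (by omega))
    refine ⟨C₃.edges, ?_, .pos C₃ ?_⟩
    · rw [hE₃]
      rintro y (rfl | ⟨t, ht, rfl⟩)
      · exact hhX
      · split_ifs
        · exact hX _ (by omega)
        · exact hgX
        · exact hX _ (by omega)
    · rw [hP₃]
      have s3 : G.sgn (j + 1 + (k - i))
          (fun t => if t < j then e t else if t = j then g else e (k - 1 - (t - j - 1))) =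
          G.sgn j e * G.sg g * G.sgn (k - i) (fun t => e (i + t)) := by
        unfold sgn
        rw [Finset.prod_range_add, Finset.prod_range_succ]
        congr 1
        · congr 1
          · apply Finset.prod_congr rfl
            intro t ht
            beta_reduce
            rw [if_pos (by simpa using ht)]
          · simp
        · rw [← Finset.prod_range_reflect]
          apply Finset.prod_congr rfl
          intro t ht
          rw [Finset.mem_range] at ht
          beta_reduce
          have a5 : k - 1 - (j + 1 + (k - i - 1 - t) - j - 1) = i + t := by omega
          rw [if_neg (by omega), if_neg (by omega), a5]
      have s1 : G.sgn i e = G.sgn j e * G.sgn (i - j) (fun t => e (j + t)) := by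
        unfold sgn
        rw [← Finset.prod_range_add (fun t => G.sg (e t)), Nat.add_sub_cancel' hij.le]
      have s2 : G.sgn (k - j) (fun t => e (j + t)) =
          G.sgn (i - j) (fun t => e (j + t)) * G.sgn (k - i) (fun t => e (i + t)) := by
        unfold sgn
        have : k - j = (i - j) + (k - i) := by omega
        rw [this, Finset.prod_range_add]
        congr 1
        apply Finset.prod_congr rfl
        intro t ht
        have a5 : j + (i - j + t) = i + t := by omega
        beta_reduce
        rw [a5]
      have n₁ : ¬ (G.sgn i e * G.sg h = 1) := fun hc => h₁ (hP₁.2 hc)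
      have n₂ : ¬ (G.sgn (k - j) (fun t => e (j + t)) * G.sg g = 1) := fun hc => h₂ (hP₂.2 hc)
      rw [s3]
      rw [s1] at n₁
      rw [s2] at n₂
      rcases sgn_cases G j e with a | a <;>
      rcases sgn_cases G (i - j) (fun t => e (j + t)) with b | b <;>
      rcases sgn_cases G (k - i) (fun t => e (i + t)) with c | c <;>
      rcases sg_cases G g with d | d <;>
      rcases sg_cases G h with f | f <;>
      simp [a, b, c, d, f] at n₁ n₂ ⊢

/-- Some other edge in the support of a kernel vector is met. -/
lemma exists_other {A : Matrix V E (ZMod 3)} (f : E →₀ ZMod 3) (hk : ∀ x, lc A f x = 0)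
    (s : Finset E) (x : V) (hx : ∑ y ∈ s, f y * A x y ≠ 0) :
    ∃ y, y ∉ s ∧ f y ≠ 0 ∧ A x y ≠ 0 := by
  classical
  by_contra! hc
  apply hx
  rw [← hk x, lc_eq_sum A f (s ∪ f.support) (fun y hy => by simp [hy])]
  apply Finset.sum_subset Finset.subset_union_left
  intro y _ hy
  by_cases h0 : f y = 0
  · simp [h0]
  · simp [hc y hy h0]

lemma NPath.rev {G : SGraph V E} {m : ℕ} {v : ℕ → V} {e : ℕ → E} (hp : G.NPath m v e) :
    G.NPath m (fun t => v (m - t)) (fun t => e (m - 1 - t)) := by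
  constructor
  · intro t ht
    have a5 : m - 1 - t + 1 = m - t := by omega
    have a6 : m - (t + 1) = m - 1 - t := by omega
    beta_reduce
    rw [hp.seg _ (by omega), Sym2.eq_swap, a5, a6]
  · intro i j hi hj hij
    have := hp.vinj _ _ (by omega) (by omega) hij
    omega

lemma exists_frameCircuit {G : SGraph V E} {A : Matrix V E (ZMod 3)} (hA : G.IsIncidence A)
    (f : E →₀ ZMod 3) (hf : f ≠ 0) (hk : ∀ x, lc A f x = 0) :
    ∃ D ⊆ {y | f y ≠ 0}, G.FrameCircuit D := by
  classical
  set X : Set E := {y | f y ≠ 0} with hXdef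
  have hinc : ∀ x y, A x y ≠ 0 → x ∈ G.ends y := by
    intro x y h
    by_contra hc
    exact h ((hA y).1 x hc)
  -- lengths of paths in X whose first vertex meets X
  let S : Set ℕ := {k | ∃ v e, G.NPath k v e ∧ (∀ t < k, e t ∈ X) ∧ ∃ y ∈ X, v 0 ∈ G.ends y}
  have hSne : S.Nonempty := by
    obtain ⟨y, hy⟩ := Finsupp.ne_iff.1 hf
    obtain ⟨u, hu⟩ : ∃ u, u ∈ G.ends y := ⟨_, Sym2.out_fst_mem _⟩
    exact ⟨0, fun _ => u, fun _ => y, ⟨fun t ht => absurd ht (by omega),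
      fun i j hi hj _ => by omega⟩, fun t ht => absurd ht (by omega), y, hy, hu⟩
  have hSbdd : BddAbove S := by
    refine ⟨f.support.card, ?_⟩
    rintro k ⟨v, e, hp, hX, -⟩
    have := Finset.card_le_card_of_injOn (s := Finset.range k) (t := f.support) e
      (fun t ht => by
        have : f (e t) ≠ 0 := hX t (by simpa using ht)
        simpa using this)
      (fun a ha b hb hab => hp.einj a b (by simpa using ha) (by simpa using hb) hab)
    simpa using this
  obtain ⟨k, hkS, hmax⟩ := hSbdd.exists_isGreatest_of_nonempty hSne
  -- edges of X at the start of a longest path return to the path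
  have hback : ∀ v e, G.NPath k v e → (∀ t < k, e t ∈ X) → ∀ y ∈ X, v 0 ∈ G.ends y →
      ∃ i ≤ k, G.ends y = s(v 0, v i) := by
    intro v e hp hX y hy hv
    obtain ⟨w, hw⟩ := hv
    by_contra! hc
    have : k + 1 ∈ S := by
      refine ⟨fun t => if t = 0 then w else v (t - 1), fun t => if t = 0 then y else e (t - 1),
        ⟨?_, ?_⟩, ?_, y, hy, ?_⟩
      · intro t ht
        by_cases h0 : t = 0
        · subst h0
          simp [hw, Sym2.eq_swap]
        · have a : t - 1 + 1 = t := by omega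
          have := hp.seg (t - 1) (by omega)
          simp only [h0, if_false]
          rw [this, a]
          simp
      · have hwne : ∀ t ≤ k, w ≠ v t := fun t ht hwt => hc t ht (by rw [hw, hwt])
        intro i j hi hj hij
        by_cases h1 : i = 0 <;> by_cases h2 : j = 0 <;>
          simp only [h1, h2, if_true, if_false] at hij
        · omega
        · exact absurd hij (hwne _ (by omega))
        · exact absurd hij.symm (hwne _ (by omega))
        · have := hp.vinj _ _ (by omega) (by omega) hij
          omega
      · intro t ht
        by_cases h0 : t = 0
        · simp only [h0, if_true]; exact hy
        · simp only [h0, if_false]; exact hX _ (by omega)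
      · simp [hw]
    have := hmax this
    omega
  have hlink : ∀ v e, G.NPath k v e → 0 < k → A (v 0) (e 0) ≠ 0 := by
    intro v e hp hk0
    refine ((hA (e 0)).2.1 (v 0) (v 1) (hp.seg 0 hk0) ?_).1
    intro h
    have := hp.vinj _ _ (by omega) (by omega) h
    omega
  have hoff : ∀ v e, G.NPath k v e → ∀ y, v 0 ∈ G.ends y → (0 < k → y ≠ e 0) →
      ∀ t < k, e t ≠ y := by
    intro v e hp y hy hne t ht hty
    rw [← hty, hp.seg t ht, Sym2.mem_iff] at hy
    rcases hy with h | h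
    · have := hp.vinj _ _ (by omega) (by omega) h
      subst this
      exact hne ht hty.symm
    · have := hp.vinj _ _ (by omega) (by omega) h
      omega
  have hend : ∀ v e, G.NPath k v e → (∀ t < k, e t ∈ X) → 0 < k →
      ∃ y ∈ X, v 0 ∈ G.ends y ∧ y ≠ e 0 := by
    intro v e hp hX hk0
    obtain ⟨y, h1, h2, h3⟩ := exists_other f hk {e 0} (v 0) (by
      simpa using ⟨hX 0 hk0, hlink v e hp hk0⟩)
    exact ⟨y, h2, hinc _ _ h3, by simpa using h1⟩
  obtain ⟨v, e, hp, hX, y₀, hy₀, hy₀v⟩ := hkS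
  have hst : ∃ h ∈ X, v 0 ∈ G.ends h ∧ (0 < k → h ≠ e 0) := by
    rcases Nat.eq_zero_or_pos k with hk0 | hk0
    · exact ⟨y₀, hy₀, hy₀v, fun h => by omega⟩
    · obtain ⟨y, h1, h2, h3⟩ := hend v e hp hX hk0
      exact ⟨y, h1, h2, fun _ => h3⟩
  obtain ⟨h, hhX, hhv, hhe⟩ := hst
  have hhe' := hoff v e hp h hhv hhe
  obtain ⟨i, hi, hih⟩ := hback v e hp hX h hhX hhv
  have hrX : ∀ t < k, e (k - 1 - t) ∈ X := fun t ht => hX _ (by omega)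
  have hst' : ∃ g ∈ X, v k ∈ G.ends g ∧ (∀ t < k, e t ≠ g) := by
    rcases Nat.eq_zero_or_pos k with hk0 | hk0
    · subst hk0
      exact ⟨h, hhX, hhv, fun t ht => by omega⟩
    · obtain ⟨y, h1, h2, h3⟩ := hend _ _ hp.rev hrX hk0
      have := hoff _ _ hp.rev y h2 (fun _ => h3)
      refine ⟨y, h1, h2, fun t ht => ?_⟩
      have a := this (k - 1 - t) (by omega)
      have b : k - 1 - (k - 1 - t) = t := by omega
      simpa only [b] using a
  obtain ⟨g, hgX, hgv, hge⟩ := hst'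
  obtain ⟨j, hj, hjg⟩ : ∃ j ≤ k, G.ends g = s(v j, v k) := by
    obtain ⟨j, hj, h⟩ := hback _ _ hp.rev hrX g hgX hgv
    refine ⟨k - j, by omega, ?_⟩
    rw [h, Sym2.eq_swap]
    simp
  by_cases hgh : g = h
  swap
  · exact double_chord hp hi hj hih hjg hgh hhe' hge hX hgX hhX
  subst hgh
  have hik : G.ends g = s(v k, v 0) := by
    have h' := hjg
    rw [hih, Sym2.eq_iff] at h'
    rcases h' with ⟨-, h'⟩ | ⟨h', h''⟩
    · rw [hih, h', Sym2.eq_swap]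
    · have := hp.vinj _ _ (by omega) (by omega) h'
      subst this
      have : i = 0 := by omega
      rw [hih, this]
  obtain ⟨C, hCn, hE, hV, -⟩ := hp.close hik hge
  have hCX : C.edges ⊆ X := by
    rw [hE]
    rintro y (rfl | ⟨t, ht, rfl⟩)
    · exact hgX
    · exact hX t ht
  by_cases hpos : C.Positive
  · exact ⟨_, hCX, .pos C hpos⟩
  obtain ⟨w, hw⟩ : ∃ w ∈ C.vertices, ∃ y ∉ C.edges, f y ≠ 0 ∧ A w y ≠ 0 := by
    obtain ⟨v₁, e₁, hN, -, hE₁, hV₁, hs₁, hm₁⟩ := C.unroll 0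
    have hneg := neg_of hpos hs₁
    have h1 : ¬ ∀ x, ∑ t ∈ Finset.range C.n, f (e₁ t) * A x (e₁ t) = 0 := by
      intro hall
      have := neg_indep hA hN hneg f hall 0 hN.pos
      have h0 : e₁ 0 ∈ X := hCX (by rw [hE₁]; exact ⟨0, hN.pos, rfl⟩)
      exact h0 this
    push Not at h1
    obtain ⟨w, hw⟩ := h1
    refine ⟨w, ?_, ?_⟩
    · by_contra hc
      apply hw
      apply Finset.sum_eq_zero
      intro t ht
      rw [A_zero hA (hN.seg t (by simpa using ht)), mul_zero]
      · rintro rfl; exact hc (hm₁ _)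
      · rintro rfl; exact hc (hm₁ _)
    · obtain ⟨y, a1, a2, a3⟩ := exists_other f hk ((Finset.range C.n).image e₁) w (by
        rw [Finset.sum_image]
        · exact hw
        · intro a ha b hb hab
          exact hN.einj a b (by simpa using ha) (by simpa using hb) hab)
      refine ⟨y, ?_, a2, a3⟩
      rw [hE₁]
      rintro ⟨t, ht, rfl⟩
      exact a1 (Finset.mem_image_of_mem _ (by simpa using ht))
  obtain ⟨⟨a, rfl⟩, y, hyC, hfy, hAy⟩ := hw
  obtain ⟨v₁, e₁, hN, hv0, hE₁, hV₁, hs₁, hm₁⟩ := C.unroll a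
  rw [hCn] at hN hE₁
  have hp₁ : G.NPath k v₁ e₁ := ⟨fun t ht => hN.seg t (by omega),
    fun a b ha hb hab => hN.vinj a b (by omega) (by omega) hab⟩
  have hmem : ∀ t ≤ k, e₁ t ∈ C.edges := by
    intro t ht
    rw [hE₁]
    exact ⟨t, by omega, rfl⟩
  have hX₁ : ∀ t < k, e₁ t ∈ X := fun t ht => hCX (hmem t ht.le)
  obtain ⟨i', hi', hy'⟩ := hback v₁ e₁ hp₁ hX₁ y hfy (by rw [hv0]; exact hinc _ _ hAy)
  refine double_chord hp₁ (g := e₁ k) (h := y) (i := i') (j := 0) hi' (by omega) hy' ?_ ?_ ?_ ?_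
    hX₁ (hCX (hmem k le_rfl)) hfy
  · rw [hN.seg k (by omega), hN.wrap, Sym2.eq_swap]
  · rintro rfl; exact hyC (hmem k le_rfl)
  · rintro t ht rfl; exact hyC (hmem t ht.le)
  · intro t ht h
    have := hN.einj t k (by omega) (by omega) h
    omega

/-- Linear independence of columns in terms of kernel vectors. -/
lemma linIndep_iff (A : Matrix V E (ZMod 3)) (X : Set E) :
    LinearIndependent (ZMod 3) (fun x : X => fun v => A v (x : E)) ↔
    ∀ f : E →₀ ZMod 3, (∀ y, f y ≠ 0 → y ∈ X) → (∀ x, lc A f x = 0) → f = 0 := by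
  have h : LinearIndependent (ZMod 3) (fun x : X => fun v => A v (x : E)) ↔
    LinearIndepOn (ZMod 3) (fun y : E => fun v => A v y) X := Iff.rfl
  rw [h, linearIndepOn_iff]
  have hlc : ∀ f : E →₀ ZMod 3,
      Finsupp.linearCombination (ZMod 3) (fun y : E => fun v => A v y) f = 0 ↔
      ∀ x, lc A f x = 0 := by
    intro f
    rw [funext_iff]
    apply forall_congr'
    intro x
    rw [Finsupp.linearCombination_apply, Finsupp.sum, Finset.sum_apply]
    rfl
  constructor
  · intro hl f hf hk
    apply hl f _ ((hlc f).2 hk)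
    rw [Finsupp.mem_supported]
    intro y hy
    exact hf y (by simpa using hy)
  · intro hl f hf hk
    apply hl f _ ((hlc f).1 hk)
    intro y hy
    rw [Finsupp.mem_supported] at hf
    exact hf (by simpa using hy)

/-- A set of columns is independent iff it contains no frame circuit. -/
lemma linIndep_iff_frame {G : SGraph V E} {A : Matrix V E (ZMod 3)} (hA : G.IsIncidence A)
    (X : Set E) : LinearIndependent (ZMod 3) (fun x : X => fun v => A v (x : E)) ↔
    ∀ D ⊆ X, ¬ G.FrameCircuit D := by
  rw [linIndep_iff]
  constructor
  · intro hl D hD hF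
    obtain ⟨⟨f, h1, h2, h3⟩, -⟩ := frameCircuit_kcirc hA hF
    exact h1 (hl f (fun y hy => hD (h2 y hy)) h3)
  · intro hl f hf hk
    by_contra hne
    obtain ⟨D, hD, hF⟩ := exists_frameCircuit hA f hne hk
    exact hl D (fun y hy => hf y (hD hy)) hF

lemma frame_minimal {G : SGraph V E} {A : Matrix V E (ZMod 3)} (hA : G.IsIncidence A)
    {C D : Set E} (hC : G.FrameCircuit C) (hD : G.FrameCircuit D) (h : D ⊆ C) : D = C := by
  obtain ⟨-, hmin⟩ := frameCircuit_kcirc hA hC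
  obtain ⟨⟨f, h1, h2, h3⟩, -⟩ := frameCircuit_kcirc hA hD
  apply h.antisymm
  intro y hy
  by_contra hyD
  apply h1
  apply hmin f (fun z hz => h (h2 z hz)) h3 y hy
  by_contra hne
  exact hyD (h2 y hne)

end SGraph

/-- every signed-graphic matroid is representable over GF(3);
more precisely, if `A` is the incidence matrix of an oriented signed graph `G`,
then the column matroid of `A` equals the frame matroid of `G`. -/
theorem colMatroid_of_incidence_eq_frameMatroid
    {V E : Type*} (G : SGraph V E) (A : Matrix V E (ZMod 3))
    (hA : G.IsIncidence A) (M : Matroid E) :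
    IsColMatroid A M ↔ G.IsFrameMatroid M := by
  have hcirc : ∀ C, M.E = Set.univ → (M.IsCircuit' C ↔ M.IsCircuit C) := by
    intro C hE
    unfold Matroid.IsCircuit'
    rw [Matroid.isCircuit_iff_forall_ssubset, Matroid.Dep, hE]
    simp
  constructor
  · rintro ⟨hE, hI⟩
    refine ⟨hE, fun C => ?_⟩
    have hI' : ∀ X, M.Indep X ↔ ∀ D ⊆ X, ¬ G.FrameCircuit D := fun X =>
      (hI X).trans (SGraph.linIndep_iff_frame hA X)
    unfold Matroid.IsCircuit'
    constructor
    · rintro ⟨-, h1, h2⟩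
      rw [hI'] at h1
      push Not at h1
      obtain ⟨D, hD, hF⟩ := h1
      rcases hD.eq_or_ssubset with rfl | hs
      · exact hF
      · exact absurd hF ((hI' D).1 (h2 D hs) D subset_rfl)
    · intro hF
      refine ⟨by rw [hE]; exact Set.subset_univ _, fun h => (hI' C).1 h C subset_rfl hF, ?_⟩
      intro D hD
      rw [hI']
      intro D' hD' hF'
      have := SGraph.frame_minimal hA hF hF' (hD'.trans hD.subset)
      exact hD.not_subset (this ▸ hD')
  · rintro ⟨hE, hC⟩
    refine ⟨hE, fun X => ?_⟩
    rw [SGraph.linIndep_iff_frame hA, Matroid.indep_iff_forall_subset_not_isCircuit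
      (by rw [hE]; exact Set.subset_univ _)]
    constructor
    · intro h D hD hF
      exact h D hD ((hcirc D hE).1 ((hC D).2 hF))
    · intro h D hD hF
      exact h D hD ((hC D).1 ((hcirc D hE).2 hF))
end

section
/- A set of edges of a signed graph Ω is independent in the frame matroid of Ω if and only if every connected component of the subgraph it induces contains at most one cycle, and that cycle (if present) is negative. -/
open Set

namespace SGraph

variable {V E : Type*}

/-- Reachability between vertices using only edges in `X`. -/
inductive Reach (G : SGraph V E) (X : Set E) : V → V → Prop
  | refl (v : V) : Reach G X v v
  | cons {u v w : V} {e : E} (he : e ∈ X) (h : G.ends e = s(u, v))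
      (hr : Reach G X v w) : Reach G X u w

end SGraph

namespace SGraph

variable {V E : Type*}

/-- Walks with vertex list (last vertex excluded) and edge list. -/
inductive Wk (G : SGraph V E) : V → List V → List E → V → Prop
  | nil (u : V) : Wk G u [] [] u
  | cons {u v w : V} {e : E} {vs : List V} {es : List E} (h : G.ends e = s(u, v))
      (hw : Wk G v vs es w) : Wk G u (u :: vs) (e :: es) w

namespace Wk

variable {G : SGraph V E}

theorem len {u v : V} {vs : List V} {es : List E} (h : Wk G u vs es v) :
    es.length = vs.length := by
  induction h with
  | nil => rfl
  | cons _ _ ih => simp [ih]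

theorem append {u v w : V} {vs vs' : List V} {es es' : List E} (h : Wk G u vs es v)
    (h' : Wk G v vs' es' w) : Wk G u (vs ++ vs') (es ++ es') w := by
  induction h with
  | nil => simpa using h'
  | cons he _ ih => exact Wk.cons he (ih h')

theorem reverse {u v : V} {vs : List V} {es : List E} (h : Wk G u vs es v) :
    ∃ vs', vs' ++ [u] = (vs ++ [v]).reverse ∧ Wk G v vs' es.reverse u := by
  induction h with
  | nil u => exact ⟨[], by simp, by simpa using Wk.nil u⟩
  | @cons u v w e vs es he hw ih =>
    obtain ⟨vs', h1, h2⟩ := ih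
    refine ⟨vs' ++ [v], by simp [h1], ?_⟩
    have := h2.append (Wk.cons (e := e) (by rw [he, Sym2.eq_swap]) (Wk.nil u))
    simpa using this

/-- Split at a vertex of the vertex list. -/
theorem split_vtx {u w x : V} {vs1 vs2 : List V} : ∀ {es : List E},
    Wk G u (vs1 ++ x :: vs2) es w →
    ∃ es1 es2, es = es1 ++ es2 ∧ Wk G u vs1 es1 x ∧ Wk G x (x :: vs2) es2 w := by
  induction vs1 generalizing u with
  | nil =>
    intro es h
    have hx : u = x := by
      cases h; rfl
    subst hx
    exact ⟨[], es, rfl, Wk.nil _, h⟩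
  | cons a t ih =>
    intro es h
    cases h with
    | cons he hw =>
      obtain ⟨es1, es2, h1, h2, h3⟩ := ih hw
      exact ⟨_ :: es1, es2, by simp [h1], Wk.cons he h2, h3⟩

/-- Split at an edge. -/
theorem split_edge {u w : V} {e : E} {vs : List V} {es : List E} (h : Wk G u vs es w)
    (he : e ∈ es) : ∃ vs1 vs2 es1 es2 a b, vs = vs1 ++ a :: vs2 ∧ es = es1 ++ e :: es2 ∧
      G.ends e = s(a, b) ∧ Wk G u vs1 es1 a ∧ Wk G b vs2 es2 w := by
  induction h with
  | nil => simp at he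
  | @cons u v w e' vs es h hw ih =>
    rcases List.mem_cons.1 he with rfl | he
    · exact ⟨[], vs, [], es, u, v, rfl, rfl, h, Wk.nil _, hw⟩
    · obtain ⟨vs1, vs2, es1, es2, a, b, h1, h2, h3, h4, h5⟩ := ih he
      exact ⟨u :: vs1, vs2, e' :: es1, es2, a, b, by simp [h1], by simp [h2], h3,
        Wk.cons h h4, h5⟩

theorem edge_vtx {u w : V} {e : E} {vs : List V} {es : List E} (h : Wk G u vs es w)
    (he : e ∈ es) : ∃ x ∈ vs, x ∈ G.ends e := by
  obtain ⟨vs1, vs2, es1, es2, a, b, h1, h2, h3, h4, h5⟩ := h.split_edge he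
  exact ⟨a, by simp [h1], by simp [h3]⟩

theorem head_eq {u w x : V} {vs : List V} {es : List E} (h : Wk G u (x :: vs) es w) :
    u = x := by
  cases h; rfl

/-- Split at the first vertex in `S`. -/
theorem first_hit {S : Set V} {u w : V} {vs : List V} {es : List E} (h : Wk G u vs es w)
    (hw : w ∈ S) : ∃ vs1 vs2 es1 es2 z, vs = vs1 ++ vs2 ∧ es = es1 ++ es2 ∧ z ∈ S ∧
      Wk G u vs1 es1 z ∧ Wk G z vs2 es2 w ∧ ∀ x ∈ vs1, x ∉ S := by
  induction h with
  | nil u => exact ⟨[], [], [], [], u, rfl, rfl, hw, Wk.nil _, Wk.nil _, by simp⟩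
  | @cons u v w e vs es he hk ih =>
    by_cases hu : u ∈ S
    · exact ⟨[], _, [], _, u, rfl, rfl, hu, Wk.nil _, Wk.cons he hk, by simp⟩
    · obtain ⟨vs1, vs2, es1, es2, z, h1, h2, h3, h4, h5, h6⟩ := ih hw
      refine ⟨u :: vs1, vs2, e :: es1, es2, z, by simp [h1], by simp [h2], h3,
        Wk.cons he h4, h5, ?_⟩
      intro x hx
      rcases List.mem_cons.1 hx with rfl | hx
      · exact hu
      · exact h6 x hx

theorem start_mem {u w : V} {vs : List V} {es : List E} (h : Wk G u vs es w) :
    u ∈ vs ++ [w] := by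
  cases h <;> simp

/-- Split at the last vertex in `S`. -/
theorem last_hit {S : Set V} {u w : V} {vs : List V} {es : List E} (h : Wk G u vs es w)
    (hu : ∃ x ∈ vs ++ [w], x ∈ S) :
    ∃ vs1 vs2 es1 es2 y r, vs = vs1 ++ vs2 ∧ es = es1 ++ es2 ∧ y ∈ S ∧
      Wk G u vs1 es1 y ∧ Wk G y vs2 es2 w ∧ vs2 ++ [w] = y :: r ∧ (∀ x ∈ r, x ∉ S) ∧
      ∀ e ∈ es2, ∃ x ∈ r, x ∈ G.ends e := by
  induction h with
  | nil u =>
    obtain ⟨x, hx, hxS⟩ := hu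
    simp at hx; subst hx
    exact ⟨[], [], [], [], x, [], rfl, rfl, hxS, Wk.nil _, Wk.nil _, rfl, by simp, by simp⟩
  | @cons u v w e vs es he hk ih =>
    by_cases hS : ∃ x ∈ vs ++ [w], x ∈ S
    · obtain ⟨vs1, vs2, es1, es2, y, r, h1, h2, h3, h4, h5⟩ := ih hS
      exact ⟨u :: vs1, vs2, e :: es1, es2, y, r, by simp [h1], by simp [h2], h3,
        Wk.cons he h4, h5⟩
    · obtain ⟨x, hx, hxS⟩ := hu
      have hxu : x = u := by
        rcases List.mem_cons.1 hx with h | h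
        · exact h
        · exact absurd ⟨x, h, hxS⟩ hS
      subst hxu
      refine ⟨[], _, [], _, x, vs ++ [w], rfl, rfl, hxS, Wk.nil _, Wk.cons he hk, rfl, ?_, ?_⟩
      · intro y hy hyS
        exact hS ⟨y, hy, hyS⟩
      · intro e' he'
        rcases List.mem_cons.1 he' with rfl | he'
        · exact ⟨v, hk.start_mem, by simp [he]⟩
        · obtain ⟨y, hy, hy'⟩ := hk.edge_vtx he'
          exact ⟨y, by simp [hy], hy'⟩

theorem get_incid {u v : V} {vs : List V} {es : List E} (h : Wk G u vs es v) :
    ∀ (i : ℕ) (hi : i < es.length) (h1 : i < (vs ++ [v]).length)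
      (h2 : i + 1 < (vs ++ [v]).length),
      G.ends es[i] = s((vs ++ [v])[i], (vs ++ [v])[i + 1]) := by
  induction h with
  | nil => intro i hi; simp at hi
  | @cons u v w e vs es he hk ih =>
    intro i hi h1 h2
    cases i with
    | zero =>
      cases hk <;> simpa using he
    | succ i =>
      simpa using ih i (by simpa using hi) (by simpa using h1) (by simpa using h2)

/-- A closed walk without repetitions is a cycle. -/
theorem toCyc {u : V} {vs : List V} {es : List E} (h : Wk G u vs es u) (hne : vs ≠ [])
    (hv : vs.Nodup) (he : es.Nodup) :
    ∃ C : Cyc G, C.edges = {e | e ∈ es} ∧ C.vertices = {x | x ∈ vs} := by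
  have hl := h.len
  have hpos : 0 < vs.length := List.length_pos_iff.2 hne
  have : NeZero vs.length := ⟨hpos.ne'⟩
  have hlt : ∀ i : ZMod vs.length, i.val < vs.length := fun i => ZMod.val_lt i
  have hlt' : ∀ i : ZMod vs.length, i.val < es.length := fun i => by rw [hl]; exact hlt i
  have hval : ∀ (k : ℕ), k < vs.length → ((k : ℕ) : ZMod vs.length).val = k :=
    fun k hk => ZMod.val_cast_of_lt hk
  refine ⟨⟨vs.length, hpos, fun i => vs[i.val]'(hlt i), fun i => es[i.val]'(hlt' i),
    ?_, ?_, ?_⟩, ?_, ?_⟩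
  · intro i j hij
    exact ZMod.val_injective _ ((hv.getElem_inj_iff).1 hij)
  · intro i j hij
    exact ZMod.val_injective _ ((he.getElem_inj_iff).1 hij)
  · intro i
    have hi := hlt i
    have := h.get_incid i.val (by omega) (by simp; omega) (by simp; omega)
    rw [this, List.getElem_append_left hi]
    refine congrArg (fun t => s(vs[i.val], t)) ?_
    by_cases hi2 : i.val + 1 < vs.length
    · have h3 : (i + 1).val = i.val + 1 := by
        have := hval _ hi2
        rw [← this]; simp
      rw [List.getElem_append_left hi2]
      simp only [h3]
    · have h3 : (i + 1).val = 0 := by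
        have h4 : i.val + 1 = vs.length := by omega
        have h5 : ((i.val + 1 : ℕ) : ZMod vs.length) = 0 := by
          rw [h4]; exact ZMod.natCast_self _
        have h6 : i + 1 = 0 := by simpa using h5
        rw [h6]; simp
      rw [List.getElem_append_right (by omega)]
      simp only [h3]
      cases h with
      | nil => exact absurd rfl hne
      | cons => simp
  · ext e
    simp only [Cyc.edges, Set.mem_range, Set.mem_ofPred_eq, List.mem_iff_getElem]
    constructor
    · rintro ⟨i, rfl⟩
      exact ⟨i.val, hlt' i, rfl⟩
    · rintro ⟨k, hk, rfl⟩
      refine ⟨(k : ZMod vs.length), ?_⟩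
      simp only [hval k (by omega)]
  · ext e
    simp only [Cyc.vertices, Set.mem_range, Set.mem_ofPred_eq, List.mem_iff_getElem]
    constructor
    · rintro ⟨i, rfl⟩
      exact ⟨i.val, hlt i, rfl⟩
    · rintro ⟨k, hk, rfl⟩
      refine ⟨(k : ZMod vs.length), ?_⟩
      simp only [hval k hk]

/-- A walk without repeated vertices is a path. -/
theorem toConnPath {S T : Set V} {u v : V} {vs : List V} {es : List E} (h : Wk G u vs es v)
    (hv : (vs ++ [v]).Nodup) (hu : u ∈ S) (hvT : v ∈ T)
    (hT : ∀ x ∈ vs, x ∉ T) (hS : ∀ x ∈ vs.tail, x ∉ S) :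
    ∃ P : ConnPath G S T, P.edges = {e | e ∈ es} := by
  have hl := h.len
  have hl' : (vs ++ [v]).length = es.length + 1 := by simp [hl]
  have hinc := h.get_incid
  refine ⟨⟨es.length, fun i => (vs ++ [v])[i.val]'(by omega), fun i => es[i.val],
    ?_, ?_, ?_, ?_, ?_, ?_⟩, ?_⟩
  · intro i j hij
    exact Fin.ext ((hv.getElem_inj_iff).1 hij)
  · intro i j hij
    have h1 := hinc i.val i.2 (by omega) (by omega)
    have h2 := hinc j.val j.2 (by omega) (by omega)
    simp only at hij
    rw [hij, h2] at h1
    rw [Sym2.eq_iff] at h1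
    simp only [hv.getElem_inj_iff] at h1
    apply Fin.ext
    omega
  · intro i
    exact hinc i.val i.2 (by omega) (by omega)
  · cases h <;> simpa using hu
  · have : (vs ++ [v])[es.length]'(by omega) = v := by
      rw [List.getElem_append_right (by omega)]; simp
    simpa [this] using hvT
  · intro i hi0 hil
    have hi0' : i.val ≠ 0 := fun h => hi0 (Fin.ext h)
    have hil' : i.val ≠ es.length := fun h => hil (Fin.ext h)
    have hi : i.val < vs.length := by have := i.2; omega
    have e1 : (vs ++ [v])[i.val]'(by omega) = vs[i.val] := List.getElem_append_left hi
    simp only [e1]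
    rintro (hx | hx)
    · refine hS _ ?_ hx
      rw [List.mem_iff_getElem]
      refine ⟨i.val - 1, by simp; omega, ?_⟩
      rw [List.getElem_tail]
      congr 1
      omega
    · exact hT _ (List.getElem_mem _) hx
  · ext e
    simp only [ConnPath.edges, Set.mem_range, Set.mem_ofPred_eq, List.mem_iff_getElem]
    constructor
    · rintro ⟨i, rfl⟩
      exact ⟨i.val, i.2, rfl⟩
    · rintro ⟨k, hk, rfl⟩
      exact ⟨⟨k, hk⟩, rfl⟩

end Wk

/-- A cycle as a closed walk starting at any of its vertices. -/
theorem Cyc.toWk {G : SGraph V E} (C : Cyc G) {x : V} (hx : x ∈ C.vertices) :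
    ∃ vs es, Wk G x vs es x ∧ vs.Nodup ∧ es.Nodup ∧ vs ≠ [] ∧
      C.vertices = {y | y ∈ vs} ∧ C.edges = {e | e ∈ es} := by
  obtain ⟨i0, rfl⟩ := hx
  have : NeZero C.n := ⟨C.hn.ne'⟩
  have key : ∀ k : ℕ, Wk G (C.vtx i0) ((List.range k).map (fun j : ℕ => C.vtx (i0 + (j : ZMod C.n))))
      ((List.range k).map (fun j : ℕ => C.edge (i0 + (j : ZMod C.n)))) (C.vtx (i0 + (k : ZMod C.n))) := by
    intro k
    induction k with
    | zero => simpa using Wk.nil _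
    | succ k ih =>
      rw [List.range_succ, List.map_append, List.map_append]
      refine ih.append (Wk.cons (C.incid _) ?_)
      have : i0 + (k : ZMod C.n) + 1 = i0 + ((k + 1 : ℕ) : ZMod C.n) := by
        push_cast; ring
      rw [this]
      exact Wk.nil _
  have hinj : ∀ a ∈ List.range C.n, ∀ b ∈ List.range C.n,
      i0 + (a : ZMod C.n) = i0 + (b : ZMod C.n) → a = b := by
    intro a ha b hb hab
    have h1 := add_left_cancel hab
    have h2 := congrArg ZMod.val h1
    rwa [ZMod.val_cast_of_lt (List.mem_range.1 ha), ZMod.val_cast_of_lt (List.mem_range.1 hb)] at h2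
  have hsurj : ∀ i : ZMod C.n, ∃ k ∈ List.range C.n, i0 + (k : ZMod C.n) = i := by
    intro i
    refine ⟨(i - i0).val, List.mem_range.2 (ZMod.val_lt _), ?_⟩
    simp
  refine ⟨(List.range C.n).map (fun j : ℕ => C.vtx (i0 + (j : ZMod C.n))),
    (List.range C.n).map (fun j : ℕ => C.edge (i0 + (j : ZMod C.n))), ?_, ?_, ?_, ?_, ?_, ?_⟩
  · simpa using key C.n
  · exact List.Nodup.map_on (fun a ha b hb hab => hinj a ha b hb (C.vtx_inj hab))
      (List.nodup_range (n := C.n))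
  · exact List.Nodup.map_on (fun a ha b hb hab => hinj a ha b hb (C.edge_inj hab))
      (List.nodup_range (n := C.n))
  · simpa using C.hn.ne'
  · ext y
    simp only [Cyc.vertices, Set.mem_range, Set.mem_ofPred_eq, List.mem_map]
    constructor
    · rintro ⟨i, rfl⟩
      obtain ⟨k, hk, rfl⟩ := hsurj i
      exact ⟨k, hk, rfl⟩
    · rintro ⟨k, _, rfl⟩
      exact ⟨_, rfl⟩
  · ext y
    simp only [Cyc.edges, Set.mem_range, Set.mem_ofPred_eq, List.mem_map]
    constructor
    · rintro ⟨i, rfl⟩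
      obtain ⟨k, hk, rfl⟩ := hsurj i
      exact ⟨k, hk, rfl⟩
    · rintro ⟨k, _, rfl⟩
      exact ⟨_, rfl⟩

open Classical in
theorem Cyc.positive_iff {G : SGraph V E} (C : Cyc G) {es : List E} (he : es.Nodup)
    (h : C.edges = {e | e ∈ es}) : C.Positive ↔ Even (es.countP (fun e => decide (e ∈ G.neg))) := by
  have h1 : C.edges ∩ G.neg = (((es.filter (fun e => decide (e ∈ G.neg))).toFinset : Finset E) : Set E) := by
    ext e; simp [h]
  unfold Cyc.Positive Cyc.PositiveIn
  rw [h1, Set.ncard_coe_finset, List.toFinset_card_of_nodup (he.filter _),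
    List.countP_eq_length_filter]

theorem Cyc.ends_mem {G : SGraph V E} (C : Cyc G) {e : E} (he : e ∈ C.edges) {x : V}
    (hx : x ∈ G.ends e) : x ∈ C.vertices := by
  obtain ⟨i, rfl⟩ := he
  rw [C.incid, Sym2.mem_iff] at hx
  rcases hx with rfl | rfl
  · exact ⟨_, rfl⟩
  · exact ⟨_, rfl⟩

/-- The theta argument. -/
theorem theta {G : SGraph V E} (C : Cyc G) (hC : C.Negative) {y z : V} (hyz : y ≠ z)
    (hy : y ∈ C.vertices) (hz : z ∈ C.vertices) {r : List V} {es : List E}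
    (hw : Wk G y (y :: r) es z) (hr : r.Nodup) (hrC : ∀ x ∈ r, x ∉ C.vertices)
    (hes : es.Nodup) (hesC : ∀ e ∈ es, e ∉ C.edges) :
    ∃ D : Cyc G, D.Positive ∧ D.edges ⊆ C.edges ∪ {e | e ∈ es} := by
  classical
  obtain ⟨vs, fs, h1, h2, h3, h4, h5, h6⟩ := C.toWk hy
  have hzv : z ∈ vs := by rw [h5] at hz; exact hz
  obtain ⟨vA, vB, rfl⟩ := List.append_of_mem hzv
  obtain ⟨fA, fB, rfl, hA, hB⟩ := h1.split_vtx
  have hneg := (C.positive_iff h3 h6).not.1 hC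
  rw [List.countP_append] at hneg
  obtain ⟨vA', rfl⟩ : ∃ t, vA = y :: t := by
    cases hA with
    | nil => exact absurd rfl hyz
    | cons => exact ⟨_, rfl⟩
  obtain ⟨q, hq, hrev⟩ := hw.reverse
  have hq' : q = z :: r.reverse := by
    have : q ++ [y] = (z :: r.reverse) ++ [y] := by rw [hq]; simp
    exact List.append_cancel_right this
  subst hq'
  have hrC' : ∀ x ∈ r, x ∉ y :: vA' ++ z :: vB := by
    intro x hx hx'
    exact hrC x hx (by rw [h5]; exact hx')
  have hesC' : ∀ e ∈ es, e ∉ fA ∧ e ∉ fB := by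
    intro e he
    have := hesC e he
    rw [h6] at this
    simpa using this
  have hvn := h2
  rw [List.nodup_append] at h2 h3
  simp only [List.mem_append, List.mem_cons, not_or] at hrC'
  by_cases hpar : Even (fB.countP (fun e => decide (e ∈ G.neg)) + es.countP (fun e => decide (e ∈ G.neg)))
  · obtain ⟨D, hD1, hD2⟩ := (hB.append hw).toCyc (by simp) (by
      rw [List.nodup_append]
      refine ⟨h2.2.1, List.nodup_cons.2 ⟨fun h => (hrC' y h).1.1 rfl, hr⟩, ?_⟩
      rintro a ha b hb rfl
      rcases List.mem_cons.1 hb with rfl | hb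
      · exact h2.2.2 a (by simp) a ha rfl
      · have := hrC' a hb
        simp only [List.mem_cons] at ha
        tauto) (by
      rw [List.nodup_append]
      refine ⟨h3.2.1, hes, ?_⟩
      rintro a ha b hb rfl
      exact (hesC' a hb).2 ha)
    refine ⟨D, (D.positive_iff ?_ hD1).2 (by rwa [List.countP_append]), ?_⟩
    · rw [List.nodup_append]
      refine ⟨h3.2.1, hes, ?_⟩
      rintro a ha b hb rfl
      exact (hesC' a hb).2 ha
    · rw [hD1, h6]
      intro e he
      simp only [Set.mem_ofPred_eq, List.mem_append, Set.mem_union] at he ⊢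
      tauto
  · have hn : (fA ++ es.reverse).Nodup := by
      rw [List.nodup_append]
      refine ⟨h3.1, List.nodup_reverse.2 hes, ?_⟩
      rintro a ha b hb rfl
      exact (hesC' a (List.mem_reverse.1 hb)).1 ha
    obtain ⟨D, hD1, hD2⟩ := (hA.append hrev).toCyc (by simp) (by
      rw [List.nodup_append]
      refine ⟨h2.1, List.nodup_cons.2 ⟨fun h => (hrC' z (List.mem_reverse.1 h)).2.1 rfl,
        List.nodup_reverse.2 hr⟩, ?_⟩
      rintro a ha b hb rfl
      rcases List.mem_cons.1 hb with rfl | hb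
      · exact h2.2.2 a ha a (by simp) rfl
      · have := hrC' a (List.mem_reverse.1 hb)
        simp only [List.mem_cons] at ha
        tauto) hn
    refine ⟨D, (D.positive_iff hn hD1).2 ?_, ?_⟩
    · rw [List.countP_append, List.countP_reverse]
      rw [Nat.even_add] at *
      tauto
    · rw [hD1, h6]
      intro e he
      simp only [Set.mem_ofPred_eq, List.mem_append, List.mem_reverse, Set.mem_union] at he ⊢
      tauto

/-- Two distinct negative cycles sharing a vertex contain a frame circuit. -/
theorem circuit_of_meet {G : SGraph V E} (C₁ C₂ : Cyc G) (h₁ : C₁.Negative) (h₂ : C₂.Negative)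
    {x : V} (hx1 : x ∈ C₁.vertices) (hx2 : x ∈ C₂.vertices) {e : E} (he2 : e ∈ C₂.edges)
    (he1 : e ∉ C₁.edges) : ∃ D, G.FrameCircuit D ∧ D ⊆ C₁.edges ∪ C₂.edges := by
  obtain ⟨vs, fs, hw, hvn, hfn, hne, hvs, hfs⟩ := C₂.toWk hx2
  have he : e ∈ fs := by rw [hfs] at he2; exact he2
  obtain ⟨va, vb, fa, fb, a, b, rfl, rfl, hab, hA, hB⟩ := hw.split_edge he
  obtain ⟨va1, va2, fa1, fa2, y, r, rfl, rfl, hy, hA1, hA2, hr, hrS, hre⟩ :=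
    hA.last_hit (S := C₁.vertices) ⟨x, hA.start_mem, hx1⟩
  obtain ⟨vb1, vb2, fb1, fb2, z, rfl, rfl, hz, hB1, hB2, hbS⟩ :=
    hB.first_hit (S := C₁.vertices) hx1
  have hP := hA2.append (Wk.cons hab hB1)
  have hlist : va2 ++ a :: vb1 = y :: (r ++ vb1) := by
    have : va2 ++ a :: vb1 = (va2 ++ [a]) ++ vb1 := by simp
    rw [this, hr]; rfl
  have htot : va1 ++ va2 ++ a :: (vb1 ++ vb2) = va1 ++ y :: (r ++ vb1) ++ vb2 := by
    rw [← hlist]; simp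
  rw [htot] at hvn hvs
  rw [hlist] at hP
  by_cases hyz : y = z
  · subst hyz
    have hb2 : vb2 = [] := by
      cases hB2 with
      | nil => rfl
      | cons => exfalso; simp [List.nodup_append] at hvn
    subst hb2
    have hyx : y = x := by cases hB2; rfl
    have ha1 : va1 = [] := by
      cases hA1 with
      | nil => rfl
      | cons => exfalso; subst hyx; simp at hvn
    subst ha1
    refine ⟨_, FrameCircuit.tight C₁ C₂ h₁ h₂ (fun h => he1 (h ▸ he2)) y ?_, subset_rfl⟩
    ext w
    constructor
    · rintro ⟨hw1, hw2⟩
      rw [hvs] at hw2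
      simp only [List.nil_append, List.append_nil, Set.mem_ofPred_eq, List.mem_cons,
        List.mem_append] at hw2
      rcases hw2 with h | h | h
      · exact h
      · exact absurd hw1 (hrS w h)
      · exact absurd hw1 (hbS w h)
    · rintro rfl
      exact ⟨hy, hyx ▸ hx2⟩
  · have hsub : ∀ f ∈ fa2 ++ e :: fb1, f ∈ C₂.edges := by
      intro f hf
      rw [hfs]
      simp only [List.mem_append, List.mem_cons, Set.mem_ofPred_eq] at hf ⊢
      tauto
    obtain ⟨D, hD, hDs⟩ := theta C₁ h₁ hyz hy hz hP
      (by
        refine hvn.sublist ?_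
        refine List.Sublist.trans ?_ (List.sublist_append_left _ _)
        exact (List.sublist_cons_self _ _).trans (List.sublist_append_right _ _))
      (by
        intro w hw
        rcases List.mem_append.1 hw with h | h
        · exact hrS w h
        · exact hbS w h)
      (by
        refine hfn.sublist ?_
        have : fa1 ++ fa2 ++ e :: (fb1 ++ fb2) = fa1 ++ (fa2 ++ e :: fb1) ++ fb2 := by simp
        rw [this]
        exact (List.sublist_append_right _ _).trans (List.sublist_append_left _ _))
      (by
        intro f hf hfC
        rcases List.mem_append.1 hf with h | h
        · obtain ⟨w, hw, hw'⟩ := hre f h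
          exact hrS w hw (C₁.ends_mem hfC hw')
        · rcases List.mem_cons.1 h with rfl | h
          · exact he1 hfC
          · obtain ⟨w, hw, hw'⟩ := hB1.edge_vtx h
            exact hbS w hw (C₁.ends_mem hfC hw'))
    refine ⟨_, FrameCircuit.pos D hD, hDs.trans ?_⟩
    exact Set.union_subset_union_right _ hsub

theorem Reach.toWk {G : SGraph V E} {X : Set E} {u v : V} (h : G.Reach X u v) :
    ∃ vs es, Wk G u vs es v ∧ ∀ e ∈ es, e ∈ X := by
  induction h with
  | refl v => exact ⟨[], [], Wk.nil _, by simp⟩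
  | cons he h _ ih =>
    obtain ⟨vs, es, h1, h2⟩ := ih
    refine ⟨_, _, Wk.cons h h1, ?_⟩
    intro e he'
    rcases List.mem_cons.1 he' with rfl | he'
    · exact he
    · exact (h2 _ (by assumption))

/-- A minimal walk between two sets gives a connecting path. -/
theorem exists_connPath {G : SGraph V E} {X : Set E} {S T : Set V} {u v : V}
    (hu : u ∈ S) (hv : v ∈ T) (h : G.Reach X u v) :
    ∃ P : ConnPath G S T, P.edges ⊆ X := by
  classical
  have hex : ∃ n, ∃ u v vs es, u ∈ S ∧ v ∈ T ∧ Wk G u vs es v ∧ (∀ e ∈ es, e ∈ X) ∧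
      vs.length = n := by
    obtain ⟨vs, es, h1, h2⟩ := h.toWk
    exact ⟨_, u, v, vs, es, hu, hv, h1, h2, rfl⟩
  obtain ⟨u, v, vs, es, hu, hv, hw, hX, hn⟩ := Nat.find_spec hex
  have hmin : ∀ u' v' vs' es', u' ∈ S → v' ∈ T → Wk G u' vs' es' v' → (∀ e ∈ es', e ∈ X) →
      vs.length ≤ vs'.length := by
    intro u' v' vs' es' a b c d
    rw [hn]
    exact Nat.find_min' hex ⟨u', v', vs', es', a, b, c, d, rfl⟩
  have hT : ∀ x ∈ vs, x ∉ T := by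
    intro x hx hxT
    obtain ⟨s, t, rfl⟩ := List.append_of_mem hx
    obtain ⟨es1, es2, rfl, w1, w2⟩ := hw.split_vtx
    have := hmin _ _ _ _ hu hxT w1 (fun e he => hX e (by simp [he]))
    simp at this
  have hS : ∀ x ∈ vs.tail, x ∉ S := by
    intro x hx hxS
    obtain ⟨s, t, hst⟩ := List.append_of_mem hx
    cases vs with
    | nil => simp at hx
    | cons c vs =>
      simp only [List.tail_cons] at hst
      subst hst
      have hw' : Wk G u ((c :: s) ++ x :: t) es v := hw
      obtain ⟨es1, es2, rfl, w1, w2⟩ := hw'.split_vtx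
      have := hmin _ _ _ _ hxS hv w2 (fun e he => hX e (by simp [he]))
      simp at this
      omega
  have hnd : vs.Nodup := by
    by_contra hnd
    obtain ⟨x, hx⟩ : ∃ x, List.Sublist [x, x] vs := by
      rw [List.nodup_iff_sublist] at hnd
      push Not at hnd
      exact hnd
    obtain ⟨s, t, rfl, hs, ht⟩ : ∃ s t, vs = s ++ t ∧ x ∈ s ∧ x ∈ t := by
      have hx' : List.Sublist ([x] ++ [x]) vs := hx
      obtain ⟨s, t, h1, h2, h3⟩ := List.append_sublist_iff.1 hx'
      exact ⟨s, t, h1, by simpa using h2, by simpa using h3⟩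
    obtain ⟨s1, s2, rfl⟩ := List.append_of_mem hs
    obtain ⟨t1, t2, rfl⟩ := List.append_of_mem ht
    have hw2 : Wk G u ((s1 ++ x :: s2 ++ t1) ++ x :: t2) es v := by simpa using hw
    obtain ⟨fs1, fs2, hfs, w1, w2⟩ := hw2.split_vtx
    have hw1 : Wk G u (s1 ++ x :: (s2 ++ (t1 ++ x :: t2))) es v := by simpa using hw
    obtain ⟨a1, a2, hes, v1, _⟩ := hw1.split_vtx
    have := hmin _ _ _ _ hu hv (v1.append w2) (by
      intro e he
      rcases List.mem_append.1 he with h | h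
      · exact hX e (by simp [hes, h])
      · exact hX e (by simp [hfs, h]))
    simp at this
    omega
  obtain ⟨P, hP⟩ := hw.toConnPath (S := S) (T := T) (by
    rw [List.nodup_append]
    refine ⟨hnd, by simp, ?_⟩
    rintro a ha b hb rfl
    rw [List.mem_singleton] at hb
    exact hT a ha (hb ▸ hv)) hu hv hT hS
  exact ⟨P, by rw [hP]; exact hX⟩

theorem ConnPath.reach {G : SGraph V E} {S T : Set V} {X : Set E} (P : ConnPath G S T)
    (hP : P.edges ⊆ X) : G.Reach X (P.vtx 0) (P.vtx (Fin.last P.n)) := by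
  have key : ∀ i : Fin (P.n + 1), G.Reach X (P.vtx i) (P.vtx (Fin.last P.n)) := by
    intro i
    induction i using Fin.reverseInduction with
    | last => exact Reach.refl _
    | cast i ih => exact Reach.cons (hP ⟨i, rfl⟩) (P.incid i) ih
  exact key 0

end SGraph

/-- a set of edges is independent in the frame matroid iff every
connected component of the subgraph it induces contains at most one cycle, and
that cycle (if present) is negative. -/
theorem frame_indep_iff
    {V E : Type*} (G : SGraph V E) (M : Matroid E) (hM : G.IsFrameMatroid M)
    (X : Set E) :
    M.Indep X ↔
      ((∀ C : SGraph.Cyc G, C.edges ⊆ X → C.Negative) ∧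
        ∀ C₁ C₂ : SGraph.Cyc G, C₁.edges ⊆ X → C₂.edges ⊆ X →
          (∃ u v, u ∈ C₁.vertices ∧ v ∈ C₂.vertices ∧ G.Reach X u v) →
          C₁.edges = C₂.edges) := by
  constructor
  · intro hX
    have hdep : ∀ D, G.FrameCircuit D → ¬ D ⊆ X := fun D hD hDX =>
      ((hM.2 D).2 hD).2.1 (hX.subset hDX)
    have hneg : ∀ C : SGraph.Cyc G, C.edges ⊆ X → C.Negative := fun C hC hp =>
      hdep _ (SGraph.FrameCircuit.pos C hp) hC
    refine ⟨hneg, ?_⟩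
    rintro C₁ C₂ hC₁ hC₂ ⟨u, v, hu, hv, huv⟩
    by_contra hne
    by_cases hdis : Disjoint C₁.vertices C₂.vertices
    · obtain ⟨P, hP⟩ := SGraph.exists_connPath hu hv huv
      exact hdep _ (SGraph.FrameCircuit.loose C₁ C₂ (hneg _ hC₁) (hneg _ hC₂) hdis P)
        (Set.union_subset (Set.union_subset hC₁ hC₂) hP)
    · obtain ⟨x, hx1, hx2⟩ := Set.not_disjoint_iff.1 hdis
      by_cases hsub : C₂.edges ⊆ C₁.edges
      · obtain ⟨e, he1, he2⟩ := Set.not_subset.1 (fun h => hne (h.antisymm hsub))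
        obtain ⟨D, hD, hDs⟩ := SGraph.circuit_of_meet C₂ C₁ (hneg _ hC₂) (hneg _ hC₁)
          hx2 hx1 he1 he2
        exact hdep D hD (hDs.trans (Set.union_subset hC₂ hC₁))
      · obtain ⟨e, he2, he1⟩ := Set.not_subset.1 hsub
        obtain ⟨D, hD, hDs⟩ := SGraph.circuit_of_meet C₁ C₂ (hneg _ hC₁) (hneg _ hC₂)
          hx1 hx2 he2 he1
        exact hdep D hD (hDs.trans (Set.union_subset hC₁ hC₂))
  · rintro ⟨hneg, huniq⟩
    by_contra hX
    have hdep : M.Dep X := ⟨hX, by rw [hM.1]; exact Set.subset_univ _⟩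
    obtain ⟨D, hDX, hD⟩ := hdep.exists_isCircuit_subset
    have hD' : M.IsCircuit' D :=
      ⟨hD.subset_ground, hD.not_indep, fun F hF => hD.ssubset_indep hF⟩
    have hF := (hM.2 D).1 hD'
    cases hF with
    | pos C h => exact hneg C hDX h
    | tight C₁ C₂ h₁ h₂ hne v hmeet =>
      have hv : v ∈ C₁.vertices ∩ C₂.vertices := by rw [hmeet]; rfl
      exact hne (huniq C₁ C₂ (Set.subset_union_left.trans hDX)
        (Set.subset_union_right.trans hDX) ⟨v, v, hv.1, hv.2, SGraph.Reach.refl v⟩)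
    | loose C₁ C₂ h₁ h₂ hV P =>
      have hE := huniq C₁ C₂ ((Set.subset_union_left.trans Set.subset_union_left).trans hDX)
        ((Set.subset_union_right.trans Set.subset_union_left).trans hDX)
        ⟨_, _, P.first_mem, P.last_mem, P.reach (Set.subset_union_right.trans hDX)⟩
      have h1 : C₁.edge 0 ∈ C₁.edges := ⟨0, rfl⟩
      have hm : C₁.vtx 0 ∈ G.ends (C₁.edge 0) := by rw [C₁.incid]; simp
      exact Set.disjoint_left.1 hV (C₁.ends_mem h1 hm) (C₂.ends_mem (hE ▸ h1) hm)
end
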